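/- For every real number x ≥ 2, the interval (x, x + 5·x^{1/7}·log x] contains a cubefree integer, i.e., there exists a positive integer n with x < n ≤ x + 5·x^{1/7}·log x such that n is not divisible by p³ for any prime p. -/

import Mathlib

/-- general spacing lemma -/
lemma cf_spacing (k : ℕ) (hk : 0 < k) (B : Finset ℕ) (φ : ℕ → ℝ) (g lo hi : ℝ) (hg : 0 < g)
    (hB : ∀ d ∈ B, lo ≤ φ d ∧ φ d ≤ hi)
    (hmono : ∀ d ∈ B, ∀ e ∈ B, d ≤ e → φ d ≤ φ e)
    (hsp : ∀ d ∈ B, ∀ e ∈ B, (k : ℕ) ≤ (B.filter (fun u => d < u ∧ u ≤ e)).card → d < e →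
      g ≤ φ e - φ d) :
    (B.card : ℝ) ≤ k + k * (max (hi - lo) 0 / g) := by
  classical
  have hmax : 0 ≤ max (hi - lo) 0 := le_max_right _ _
  induction hn : B.card using Nat.strong_induction_on generalizing B lo with
  | _ n ih =>
  by_cases hle : n ≤ k
  · have : (n : ℝ) ≤ k := by exact_mod_cast hle
    have : 0 ≤ (k:ℝ) * (max (hi - lo) 0 / g) := by positivity
    linarith
  push Not at hle
  have hne : B.Nonempty := by
    rw [← Finset.card_pos]; omega
  set E := B.orderEmbOfFin hn with hE
  have hEm : ∀ i, E i ∈ B := fun i => Finset.orderEmbOfFin_mem B hn i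
  set d0 := E ⟨0, by omega⟩ with hd0
  set d1 := E ⟨k, by omega⟩ with hd1
  have hlt : d0 < d1 := by
    apply (OrderEmbedding.lt_iff_lt E).2
    exact hk
  have hrange : ∀ u ∈ B, ∃ i, E i = u := by
    intro u hu
    have := Finset.range_orderEmbOfFin B hn
    have h2 : u ∈ Set.range E := by rw [hE, this]; exact hu
    exact h2
  have hcardlt : (B.filter (fun u => u < d1)).card = k := by
    have : B.filter (fun u => u < d1) = (Finset.univ.filter (fun i : Fin n => i.1 < k)).image E := by
      ext u
      simp only [Finset.mem_filter, Finset.mem_image, Finset.mem_univ, true_and]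
      constructor
      · rintro ⟨hu, hu2⟩
        obtain ⟨i, rfl⟩ := hrange u hu
        refine ⟨i, ?_, rfl⟩
        exact (OrderEmbedding.lt_iff_lt E).1 hu2
      · rintro ⟨i, hi, rfl⟩
        exact ⟨hEm i, (OrderEmbedding.lt_iff_lt E).2 hi⟩
    rw [this, Finset.card_image_of_injective _ E.injective]
    rw [Fin.card_filter_val_lt]
    omega
  have hd0le : ∀ u ∈ B, d0 ≤ u := by
    intro u hu
    obtain ⟨i, rfl⟩ := hrange u hu
    exact (OrderEmbedding.le_iff_le E).2 (Nat.zero_le _)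
  have hcard2 : k ≤ (B.filter (fun u => d0 < u ∧ u ≤ d1)).card := by
    have hsub : (insert d1 ((B.filter (fun u => u < d1)).erase d0)) ⊆
        B.filter (fun u => d0 < u ∧ u ≤ d1) := by
      intro u hu
      simp only [Finset.mem_insert, Finset.mem_erase, Finset.mem_filter] at hu ⊢
      rcases hu with rfl | ⟨h1, h2, h3⟩
      · exact ⟨hEm _, hlt, le_refl _⟩
      · have := hd0le u h2
        exact ⟨h2, by omega, by omega⟩
    have := Finset.card_le_card hsub
    rw [Finset.card_insert_of_notMem, Finset.card_erase_of_mem, hcardlt] at this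
    · omega
    · simp only [Finset.mem_filter]; exact ⟨hEm _, hlt⟩
    · simp
  have hgap := hsp d0 (hEm _) d1 (hEm _) hcard2 hlt
  set B' := B.filter (fun u => d1 ≤ u) with hB'
  have hcB' : B'.card = n - k := by
    have := Finset.card_filter_add_card_filter_not (s := B) (fun u => u < d1)
    simp only [not_lt] at this
    rw [hcardlt, hn] at this
    rw [hB']; omega
  have hlo1 := hB d0 (hEm _)
  have hhi1 := hB d1 (hEm _)
  have key := ih (n - k) (by omega) B' (φ d1) (fun d hd => by
      rw [hB', Finset.mem_filter] at hd
      exact ⟨hmono _ (hEm _) _ hd.1 hd.2, (hB d hd.1).2⟩)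
    (fun d hd e he => hmono d (Finset.mem_filter.1 hd).1 e (Finset.mem_filter.1 he).1)
    (fun d hd e he hc => hsp d (Finset.mem_filter.1 hd).1 e (Finset.mem_filter.1 he).1
      (hc.trans (Finset.card_le_card (by
        intro u hu
        simp only [Finset.mem_filter, hB'] at hu ⊢
        exact ⟨hu.1.1, hu.2⟩)))) (le_max_right _ _) hcB'
  have e1 : max (hi - φ d1) 0 = hi - φ d1 := max_eq_left (by linarith)
  have e2 : max (hi - lo) 0 = hi - lo := max_eq_left (by linarith)
  rw [e1] at key
  rw [e2]
  rw [Nat.cast_sub hle.le] at key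
  have : (hi - φ d1) / g + 1 ≤ (hi - lo) / g := by
    rw [div_add_one hg.ne']
    gcongr
    linarith
  have hk' : (0:ℝ) < k := by exact_mod_cast hk
  nlinarith

/-- simple spacing -/
lemma cf_spacing1 (B : Finset ℕ) (φ : ℕ → ℝ) (g lo hi : ℝ) (hg : 0 < g)
    (hB : ∀ d ∈ B, lo ≤ φ d ∧ φ d ≤ hi)
    (hsp : ∀ d ∈ B, ∀ e ∈ B, d < e → g ≤ φ e - φ d) :
    (B.card : ℝ) ≤ 1 + max (hi - lo) 0 / g := by
  have := cf_spacing 1 one_pos B φ g lo hi hg hB (fun d hd e he hde => by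
    rcases hde.eq_or_lt with rfl | h
    · exact le_rfl
    · linarith [hsp d hd e he h]) (fun d hd e he _ h => hsp d hd e he h)
  simpa using this

/-- two-step spacing -/
lemma cf_spacing2 (B : Finset ℕ) (φ : ℕ → ℝ) (g lo hi : ℝ) (hg : 0 < g)
    (hB : ∀ d ∈ B, lo ≤ φ d ∧ φ d ≤ hi)
    (hmono : ∀ d ∈ B, ∀ e ∈ B, d ≤ e → φ d ≤ φ e)
    (hsp : ∀ d ∈ B, ∀ u ∈ B, ∀ e ∈ B, d < u → u < e → g ≤ φ e - φ d) :
    (B.card : ℝ) ≤ 2 + 2 * (max (hi - lo) 0 / g) := by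
  have := cf_spacing 2 two_pos B φ g lo hi hg hB hmono (fun d hd e he hc h => by
    have h1 : 1 < (B.filter (fun u => d < u ∧ u ≤ e)).card := by omega
    obtain ⟨u, hu, hue⟩ := Finset.exists_mem_ne h1 e
    simp only [Finset.mem_filter] at hu
    exact hsp d hd u hu.1 e he hu.2.1 (lt_of_le_of_ne hu.2.2 hue))
  simpa using this

lemma cf_sum_inv_cube (P : Finset ℕ) (hP : ∀ p ∈ P, p.Prime) :
    ∑ p ∈ P, (1 : ℝ) / (p : ℝ) ^ 3 ≤ 0.1755 := by
  classical
  have htail : ∀ M : ℕ, ∑ j ∈ Finset.range M, (1:ℝ) / ((11 + 2 * j : ℕ) : ℝ) ^ 3 ≤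
      1 / 400 - 1 / (4 * (10 + 2 * (M:ℝ)) ^ 2) := by
    intro M
    induction M with
    | zero => norm_num
    | succ M ih =>
      rw [Finset.sum_range_succ]
      have : (1:ℝ) / ((11 + 2 * M : ℕ) : ℝ) ^ 3 ≤
          1 / (4 * (10 + 2 * (M:ℝ)) ^ 2) - 1 / (4 * (10 + 2 * ((M + 1 : ℕ):ℝ)) ^ 2) := by
        push_cast
        have hM : (0:ℝ) ≤ M := Nat.cast_nonneg M
        set n : ℝ := 11 + 2 * (M:ℝ) with hn
        have e1 : 10 + 2 * (M:ℝ) = n - 1 := by rw [hn]; ring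
        have e2 : 10 + 2 * ((M:ℝ) + 1) = n + 1 := by rw [hn]; ring
        rw [e1, e2]
        have hn11 : 11 ≤ n := by rw [hn]; linarith
        have h1 : 0 < n - 1 := by linarith
        rw [div_sub_div _ _ (by positivity) (by positivity), div_le_div_iff₀ (by positivity) (by positivity)]
        have : n^2 ≥ 121 := by nlinarith
        nlinarith [mul_pos h1 h1]
      linarith
  set M := P.sup id + 1 with hM
  have hsub : P ⊆ ({2, 3, 5, 7} : Finset ℕ) ∪ (Finset.range M).image (fun j : ℕ => 11 + 2 * j) := by
    intro p hp
    have hpp := hP p hp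
    have hpM : p < M := by
      have := Finset.le_sup (f := id) hp
      simp only [id] at this
      omega
    simp only [Finset.mem_union, Finset.mem_insert, Finset.mem_singleton, Finset.mem_image, Finset.mem_range]
    by_cases h11 : p < 11
    · left
      interval_cases p <;> revert hpp <;> norm_num
    · right
      have hodd : p % 2 = 1 := by
        rcases hpp.eq_two_or_odd with h | h
        · omega
        · exact h
      exact ⟨(p - 11) / 2, by omega, by omega⟩
  calc ∑ p ∈ P, (1 : ℝ) / (p : ℝ) ^ 3 ≤ ∑ p ∈ (({2, 3, 5, 7} : Finset ℕ) ∪ (Finset.range M).image (fun j : ℕ => 11 + 2 * j) : Finset ℕ), (1 : ℝ) / (p : ℝ) ^ 3 :=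
        Finset.sum_le_sum_of_subset_of_nonneg hsub (fun _ _ _ => by positivity)
    _ ≤ ∑ p ∈ ({2, 3, 5, 7} : Finset ℕ), (1 : ℝ) / (p : ℝ) ^ 3 + ∑ p ∈ ((Finset.range M).image (fun j : ℕ => 11 + 2 * j) : Finset ℕ), (1 : ℝ) / (p : ℝ) ^ 3 := by
        rw [← Finset.sum_union_inter]
        have : 0 ≤ ∑ p ∈ (({2, 3, 5, 7} : Finset ℕ) ∩ (Finset.range M).image (fun j : ℕ => 11 + 2 * j) : Finset ℕ), (1 : ℝ) / (p : ℝ) ^ 3 :=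
          Finset.sum_nonneg (fun _ _ => by positivity)
        linarith
    _ ≤ 0.1755 := by
        rw [Finset.sum_image (by intro a _ b _ h; simp at h; omega)]
        have h1 := htail M
        have h2 : (0:ℝ) ≤ 1 / (4 * (10 + 2 * (M:ℝ)) ^ 2) := by positivity
        have h3 : ∑ p ∈ ({2, 3, 5, 7} : Finset ℕ), (1 : ℝ) / (p : ℝ) ^ 3 ≤ 0.17297 := by
          norm_num [Finset.sum_insert]
        linarith

lemma cf_count_main (x h : ℝ) (hx : 0 ≤ x) (hh : 0 < h)
    (hno : ∀ n : ℕ, x < n → (n : ℝ) ≤ x + h → ∃ p : ℕ, p.Prime ∧ p ^ 3 ∣ n)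
    (P : Finset ℕ) (hP' : ∀ p ∈ P, p.Prime)
    (hP : ∀ p : ℕ, p.Prime → (∃ m : ℕ, x < m * (p:ℝ) ^ 3 ∧ m * (p:ℝ) ^ 3 ≤ x + h) → p ∈ P) :
    h - 1 ≤ 0.1755 * h + P.card := by
  classical
  set I := Finset.Ioc ⌊x⌋₊ ⌊x + h⌋₊ with hI
  have hIm : ∀ n ∈ I, x < n ∧ (n : ℝ) ≤ x + h := by
    intro n hn
    rw [hI, Finset.mem_Ioc] at hn
    exact ⟨(Nat.floor_lt hx).1 hn.1, (Nat.le_floor_iff (by linarith)).1 hn.2⟩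
  have hcard : h - 1 ≤ (I.card : ℝ) := by
    rw [hI, Nat.card_Ioc]
    have h1 : ⌊x⌋₊ ≤ ⌊x + h⌋₊ := Nat.floor_mono (by linarith)
    rw [Nat.cast_sub h1]
    have h2 := Nat.floor_le hx
    have h3 := Nat.lt_floor_add_one (x + h)
    linarith
  have hsub : I ⊆ P.biUnion (fun p => I.filter (fun n => p ^ 3 ∣ n)) := by
    intro n hn
    obtain ⟨h1, h2⟩ := hIm n hn
    obtain ⟨p, hp, hpn⟩ := hno n h1 h2
    rw [Finset.mem_biUnion]
    refine ⟨p, hP p hp ?_, Finset.mem_filter.2 ⟨hn, hpn⟩⟩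
    obtain ⟨m, hm⟩ := hpn
    refine ⟨m, ?_⟩
    have : (n : ℝ) = m * (p:ℝ)^3 := by rw [hm]; push_cast; ring
    rw [← this]; exact ⟨h1, h2⟩
  have hc : ∀ p ∈ P, ((I.filter (fun n => p ^ 3 ∣ n)).card : ℝ) ≤ 1 + h * (1 / (p:ℝ) ^ 3) := by
    intro p hp
    have hpp : (0:ℝ) < (p:ℝ)^3 := by
      have := (hP' p hp).pos
      positivity
    have := cf_spacing1 (I.filter (fun n => p ^ 3 ∣ n)) (fun n => (n:ℝ)) ((p:ℝ)^3) x (x + h) hpp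
      (fun d hd => by
        have := hIm d (Finset.mem_filter.1 hd).1
        exact ⟨this.1.le, this.2⟩)
      (fun d hd e he hde => by
        have h1 := (Finset.mem_filter.1 hd).2
        have h2 := (Finset.mem_filter.1 he).2
        have h3 := Nat.le_of_dvd (by omega) (Nat.dvd_sub h2 h1)
        have h4 : ((p ^ 3 : ℕ) : ℝ) ≤ ((e - d : ℕ) : ℝ) := by exact_mod_cast h3
        rw [Nat.cast_sub hde.le] at h4
        push_cast at h4
        exact h4)
    rw [show x + h - x = h by ring, max_eq_left hh.le] at this
    rw [mul_one_div]; exact this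
  have h1 : (I.card : ℝ) ≤ ∑ p ∈ P, (1 + h * (1 / (p:ℝ) ^ 3)) := by
    calc (I.card : ℝ) ≤ ((P.biUnion (fun p => I.filter (fun n => p ^ 3 ∣ n))).card : ℝ) := by
          exact_mod_cast Finset.card_le_card hsub
      _ ≤ ((∑ p ∈ P, (I.filter (fun n => p ^ 3 ∣ n)).card : ℕ) : ℝ) := by
          exact_mod_cast Finset.card_biUnion_le
      _ = ∑ p ∈ P, ((I.filter (fun n => p ^ 3 ∣ n)).card : ℝ) := by push_cast; rfl
      _ ≤ _ := Finset.sum_le_sum hc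
  rw [Finset.sum_add_distrib, ← Finset.mul_sum] at h1
  have h2 := cf_sum_inv_cube P hP'
  simp at h1
  have h3 : ∑ p ∈ P, (1 : ℝ) / (p : ℝ) ^ 3 = ∑ p ∈ P, ((p : ℝ) ^ 3)⁻¹ := by simp
  rw [h3] at h2
  nlinarith

lemma cf_primes_le (P : Finset ℕ) (hP : ∀ p ∈ P, p.Prime) (w : ℝ) (hw : 0 ≤ w)
    (hPw : ∀ p ∈ P, (p:ℝ) ≤ w) : (P.card : ℝ) ≤ w / 3 + 3 := by
  have hsub : P ⊆ (Finset.range (⌊w⌋₊ + 1)).filter Nat.Prime := by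
    intro p hp
    rw [Finset.mem_filter, Finset.mem_range]
    exact ⟨Nat.lt_succ_of_le (Nat.le_floor (hPw p hp)), hP p hp⟩
  have h1 := Finset.card_le_card hsub
  have h2 : ((Finset.range (⌊w⌋₊ + 1)).filter Nat.Prime).card = Nat.primeCounting' (⌊w⌋₊ + 1) := by
    rw [Nat.primeCounting', Nat.count_eq_card_filter_range]
  rw [h2] at h1
  have h7 : Nat.primeCounting' 7 = 3 := by decide
  have hf := Nat.floor_le hw
  by_cases h6 : ⌊w⌋₊ < 6
  · have : Nat.primeCounting' (⌊w⌋₊ + 1) ≤ Nat.primeCounting' 7 := Nat.monotone_primeCounting' (by omega)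
    have : P.card ≤ 3 := by omega
    have : (P.card : ℝ) ≤ 3 := by exact_mod_cast this
    linarith
  · have h3 := Nat.primeCounting'_add_le (a := 6) (k := 7) (by norm_num) (by norm_num) (⌊w⌋₊ - 6)
    rw [show 7 + (⌊w⌋₊ - 6) = ⌊w⌋₊ + 1 by omega, h7, show Nat.totient 6 = 2 by decide] at h3
    have : 3 * P.card ≤ ⌊w⌋₊ + 9 := by omega
    have : (3:ℝ) * P.card ≤ ⌊w⌋₊ + 9 := by exact_mod_cast this
    linarith

lemma cf_pi_bound (P : Finset ℕ) (hP : ∀ p ∈ P, p.Prime) (y w : ℝ) (hw : 1 < w) (hy : 0 ≤ y)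
    (hPy : ∀ p ∈ P, (p:ℝ) ≤ y) : (P.card : ℝ) ≤ w / 3 + 3 + Real.log 4 * y / Real.log w := by
  classical
  have h1 := Finset.card_filter_add_card_filter_not (s := P) (fun p : ℕ => (p:ℝ) ≤ w)
  have h2 := cf_primes_le (P.filter (fun p : ℕ => (p:ℝ) ≤ w)) (fun p hp => hP p (Finset.mem_filter.1 hp).1) w
    (by linarith) (fun p hp => (Finset.mem_filter.1 hp).2)
  have hlw := Real.log_pos hw
  have h3 : ((P.filter (fun p : ℕ => ¬ (p:ℝ) ≤ w)).card : ℝ) * Real.log w ≤ Real.log 4 * y := by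
    refine le_trans ?_ (Chebyshev.theta_le_log4_mul_x hy)
    rw [Chebyshev.theta_eq_sum_Icc, ← nsmul_eq_mul, ← Finset.sum_const]
    calc ∑ p ∈ P.filter (fun p : ℕ => ¬ (p:ℝ) ≤ w), Real.log w
        ≤ ∑ p ∈ P.filter (fun p : ℕ => ¬ (p:ℝ) ≤ w), Real.log p := by
          apply Finset.sum_le_sum
          intro p hp
          have := (Finset.mem_filter.1 hp).2
          push Not at this
          exact Real.log_le_log (by linarith) this.le
      _ ≤ _ := by
          apply Finset.sum_le_sum_of_subset_of_nonneg
          · intro p hp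
            have h := (Finset.mem_filter.1 hp).1
            simp only [Finset.mem_filter, Finset.mem_Icc]
            exact ⟨⟨Nat.zero_le _, Nat.le_floor (hPy p h)⟩, hP p h⟩
          · intro p hp _
            exact Real.log_natCast_nonneg p
  have h4 : ((P.filter (fun p : ℕ => ¬ (p:ℝ) ≤ w)).card : ℝ) ≤ Real.log 4 * y / Real.log w := by
    rw [le_div_iff₀ hlw]; exact h3
  have h5 : (P.card : ℝ) = ((P.filter (fun p : ℕ => (p:ℝ) ≤ w)).card : ℝ) + ((P.filter (fun p : ℕ => ¬ (p:ℝ) ≤ w)).card : ℝ) := by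
    rw [← h1]; push_cast; rfl
  linarith

lemma cf_F (x h d c m n : ℝ) (hh : 0 < h) (hd : 0 < d) (hc : 0 < c) (h2 : 2 * c ≤ d)
    (m1 : x < m * d ^ 3) (m2 : m * d ^ 3 ≤ x + h)
    (n1 : x < n * (d + 6 * c) ^ 3) (n2 : n * (d + 6 * c) ^ 3 ≤ x + h) :
    |m * (d ^ 2 - 3 * d * c + 6 * c ^ 2) - n * (d ^ 2 + 15 * d * c + 60 * c ^ 2)
      - 1296 * x * c ^ 5 / (d ^ 3 * (d + 6 * c) ^ 3)| < h / d := by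
  have he : 0 < d + 6 * c := by linarith
  have hd3 : 0 < d ^ 3 := by positivity
  have he3 : 0 < (d + 6 * c) ^ 3 := by positivity
  have hD : 0 < d ^ 2 - 3 * d * c + 6 * c ^ 2 := by nlinarith [sq_nonneg (2 * d - 3 * c)]
  have hN : 0 < d ^ 2 + 15 * d * c + 60 * c ^ 2 := by positivity
  have key : m * (d ^ 2 - 3 * d * c + 6 * c ^ 2) - n * (d ^ 2 + 15 * d * c + 60 * c ^ 2)
      - 1296 * x * c ^ 5 / (d ^ 3 * (d + 6 * c) ^ 3) =
      (m * d ^ 3 - x) * ((d ^ 2 - 3 * d * c + 6 * c ^ 2) / d ^ 3) -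
      (n * (d + 6 * c) ^ 3 - x) * ((d ^ 2 + 15 * d * c + 60 * c ^ 2) / (d + 6 * c) ^ 3) := by
    field_simp
    ring
  have b1 : (d ^ 2 - 3 * d * c + 6 * c ^ 2) / d ^ 3 ≤ 1 / d := by
    rw [div_le_div_iff₀ hd3 hd]
    nlinarith [mul_pos hd hc, mul_nonneg (mul_pos hd hc).le (sub_nonneg.2 h2)]
  have b2 : (d ^ 2 + 15 * d * c + 60 * c ^ 2) / (d + 6 * c) ^ 3 ≤ 1 / d := by
    rw [div_le_div_iff₀ he3 hd]
    have : 0 < d * d * c := by positivity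
    have : 0 < d * c * c := by positivity
    have : 0 < c * c * c := by positivity
    nlinarith
  have p1 : 0 < (d ^ 2 - 3 * d * c + 6 * c ^ 2) / d ^ 3 := by positivity
  have p2 : 0 < (d ^ 2 + 15 * d * c + 60 * c ^ 2) / (d + 6 * c) ^ 3 := by positivity
  rw [key]
  have q1 : (m * d ^ 3 - x) * ((d ^ 2 - 3 * d * c + 6 * c ^ 2) / d ^ 3) ≤ h * (1 / d) := by
    apply mul_le_mul (by linarith) b1 p1.le hh.le
  have q2 : (n * (d + 6 * c) ^ 3 - x) * ((d ^ 2 + 15 * d * c + 60 * c ^ 2) / (d + 6 * c) ^ 3) ≤ h * (1 / d) := by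
    apply mul_le_mul (by linarith) b2 p2.le hh.le
  have q3 := mul_pos (sub_pos.2 m1) p1
  have q4 := mul_pos (sub_pos.2 n1) p2
  rw [mul_one_div] at q1 q2
  rw [abs_lt]; constructor <;> linarith

/-- divisibility in the case `v = 0` -/
lemma cf_dvd (d c m n : ℕ) (hd : d.Prime) (hd3 : 3 < d) (hc : 0 < c) (hcd : c < d)
    (hF : (m : ℤ) * ((d:ℤ) ^ 2 - 3 * d * c + 6 * c ^ 2) - n * ((d:ℤ) ^ 2 + 15 * d * c + 60 * c ^ 2) = 0) :
    (d ^ 2 + 15 * d * c + 60 * c ^ 2) ∣ 16 * m := by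
  set N := d ^ 2 + 15 * d * c + 60 * c ^ 2 with hN
  have hdc : Nat.Coprime d c := by
    rw [Nat.Prime.coprime_iff_not_dvd hd]
    intro h
    have := Nat.le_of_dvd hc h
    omega
  have c1 : Nat.Coprime N c := by
    have : N = d ^ 2 + c * (15 * d + 60 * c) := by rw [hN]; ring
    rw [this, Nat.coprime_add_mul_left_left]
    exact Nat.Coprime.pow_left 2 hdc
  have c2 : Nat.Coprime N 3 := by
    have : N = d ^ 2 + 3 * (5 * d * c + 20 * c ^ 2) := by rw [hN]; ring
    rw [this, Nat.coprime_add_mul_left_left]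
    exact Nat.Coprime.pow_left 2 ((Nat.coprime_primes hd Nat.prime_three).2 (by omega))
  have c3 : Nat.Coprime N (3 ^ 3 * c ^ 3) :=
    Nat.Coprime.mul_right (Nat.Coprime.pow_right 3 c2) (Nat.Coprime.pow_right 3 c1)
  have hdv : (N : ℤ) ∣ ((16 * m * (3 ^ 3 * c ^ 3) : ℕ) : ℤ) := by
    refine ⟨n * (d + 12 * c) - m * (d - 6 * c), ?_⟩
    rw [hN]; push_cast
    linear_combination ((d:ℤ) + 12 * c) * hF
  exact (Nat.Coprime.dvd_of_dvd_mul_right c3 (Int.natCast_dvd_natCast.1 hdv))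

/-- uniqueness of `d` for given `k, c` -/
lemma cf_uniq (x h : ℝ) (hh : 1 ≤ h) (k c d e m n : ℕ) (hk : 0 < k) (hde : d < e) (hd : 3 * h < d)
    (h1 : 16 * m = (d ^ 2 + 15 * d * c + 60 * c ^ 2) * k)
    (h2 : 16 * n = (e ^ 2 + 15 * e * c + 60 * c ^ 2) * k)
    (m1 : x < m * (d : ℝ) ^ 3) (n2 : n * (e:ℝ) ^ 3 ≤ x + h) : False := by
  have h1' : (16:ℝ) * m = ((d:ℝ) ^ 2 + 15 * d * c + 60 * c ^ 2) * k := by exact_mod_cast h1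
  have h2' : (16:ℝ) * n = ((e:ℝ) ^ 2 + 15 * e * c + 60 * c ^ 2) * k := by exact_mod_cast h2
  have hk' : (1:ℝ) ≤ k := by exact_mod_cast hk
  have hde' : (d:ℝ) + 1 ≤ e := by exact_mod_cast hde
  have hc' : (0:ℝ) ≤ c := Nat.cast_nonneg c
  have hd0 : (0:ℝ) < d := by linarith
  have a1 : ((d:ℝ) + 1) ^ 5 + 15 * d ^ 4 * c + 60 * d ^ 3 * c ^ 2 ≤ ((e:ℝ) ^ 2 + 15 * e * c + 60 * c ^ 2) * e ^ 3 := by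
    have : ((e:ℝ) ^ 2 + 15 * e * c + 60 * c ^ 2) * e ^ 3 = (e:ℝ) ^ 5 + 15 * e ^ 4 * c + 60 * e ^ 3 * c ^ 2 := by ring
    rw [this]
    have hde2 : (d:ℝ) ≤ e := by linarith
    gcongr
  have a2 : ((d:ℝ) ^ 2 + 15 * d * c + 60 * c ^ 2) * d ^ 3 + 5 * d ^ 4 ≤ ((e:ℝ) ^ 2 + 15 * e * c + 60 * c ^ 2) * e ^ 3 := by
    refine le_trans ?_ a1
    have : (0:ℝ) < 10 * d ^ 3 + 10 * d ^ 2 + 5 * d + 1 := by positivity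
    nlinarith
  have a3 : 16 * (n * (e:ℝ) ^ 3 - m * (d:ℝ) ^ 3) ≥ 5 * (d:ℝ) ^ 4 := by
    have : 16 * (n * (e:ℝ) ^ 3 - m * (d:ℝ) ^ 3) = k * (((e:ℝ) ^ 2 + 15 * e * c + 60 * c ^ 2) * e ^ 3 - ((d:ℝ) ^ 2 + 15 * d * c + 60 * c ^ 2) * d ^ 3) := by
      linear_combination (e:ℝ) ^ 3 * h2' - (d:ℝ) ^ 3 * h1'
    rw [this]
    have h0 : 0 ≤ 5 * (d:ℝ) ^ 4 := by positivity
    nlinarith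
  have a4 : (d:ℝ) ^ 4 ≥ 27 * d := by
    have : (d:ℝ) ^ 3 ≥ 3 ^ 3 := by gcongr; linarith
    nlinarith
  linarith

/-- bound on `k c^5` -/
lemma cf_kc5 (x h d c k m X : ℝ) (hx : 0 < x) (hh : 0 < h) (hd : 0 < d) (hc : 0 < c) (hk : 0 < k)
    (hX : 72 ≤ X) (hxh : 10000 * h ≤ x) (hcX : 30 * c * X < d)
    (h1 : 16 * m = (d ^ 2 + 15 * d * c + 60 * c ^ 2) * k)
    (m2 : m * d ^ 3 ≤ x + h)
    (hmu : 1296 * x * c ^ 5 / (d ^ 3 * (d + 6 * c) ^ 3) < h / d) : k * c ^ 5 < h / 80 := by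
  have he : d + 6 * c ≤ 1.0028 * d := by nlinarith
  have he3 : (d + 6 * c) ^ 3 ≤ 1.0085 * d ^ 3 := by
    calc (d + 6 * c) ^ 3 ≤ (1.0028 * d) ^ 3 := by gcongr
      _ = 1.0028 ^ 3 * d ^ 3 := by ring
      _ ≤ _ := by gcongr; norm_num
  have hkd : k * d ^ 5 ≤ 16 * (x + h) := by
    have : 16 * (m * d ^ 3) = k * d ^ 5 + k * (15 * d ^ 4 * c + 60 * d ^ 3 * c ^ 2) := by
      linear_combination d ^ 3 * h1
    have : 0 < k * (15 * d ^ 4 * c + 60 * d ^ 3 * c ^ 2) := by positivity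
    linarith
  have hm : 1296 * x * c ^ 5 < h * (1.0085 * d ^ 5) := by
    rw [div_lt_div_iff₀ (by positivity) hd] at hmu
    have : h * (d ^ 3 * (d + 6 * c) ^ 3) ≤ h * (d ^ 3 * (1.0085 * d ^ 3)) := by gcongr
    have h3 : (1296 * x * c ^ 5) * d < (h * (1.0085 * d ^ 5)) * d := by linarith
    exact lt_of_mul_lt_mul_right h3 hd.le
  have h4 : 1296 * x * (k * c ^ 5) < h * (1.0085 * (16 * (1.0001 * x))) := by
    calc 1296 * x * (k * c ^ 5) = k * (1296 * x * c ^ 5) := by ring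
      _ < k * (h * (1.0085 * d ^ 5)) := by gcongr
      _ = h * (1.0085 * (k * d ^ 5)) := by ring
      _ ≤ h * (1.0085 * (16 * (1.0001 * x))) := by
          have hkd2 : k * d ^ 5 ≤ 16 * (1.0001 * x) := by linarith
          gcongr
  have h5 : x * (k * c ^ 5) < x * (h / 80) := by nlinarith [mul_pos hx hh]
  exact lt_of_mul_lt_mul_left h5 hx.le

lemma cf_poly (w : ℝ) (hw0 : 0 ≤ w) (hw3 : w ≤ 1 / 3) : 1 + w ≤ (1 - w) * (1 + 0.37 * w) ^ 6 := by
  have t1 : 1 + 2.22 * w + 2.05 * w ^ 2 + 1.013 * w ^ 3 ≤ (1 + 0.37 * w) ^ 6 := by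
    have e : (1 + 0.37 * w) ^ 6 = 1 + 2.22 * w + 2.05 * w ^ 2 + 1.013 * w ^ 3 + (0.0035 * w ^ 2 + 0.00006 * w ^ 3
       + 15 * (0.37 * w) ^ 4 + 6 * (0.37 * w) ^ 5 + (0.37 * w) ^ 6) := by ring
    have : 0 ≤ (0.0035 * w ^ 2 + 0.00006 * w ^ 3
       + 15 * (0.37 * w) ^ 4 + 6 * (0.37 * w) ^ 5 + (0.37 * w) ^ 6) := by positivity
    linarith
  have t2 : 1 + w ≤ (1 - w) * (1 + 2.22 * w + 2.05 * w ^ 2 + 1.013 * w ^ 3) := by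
    have e1 : w ^ 2 ≤ 1 / 9 := by nlinarith
    have e2 : w ^ 3 ≤ 1 / 27 := by
      calc w ^ 3 ≤ (1 / 3) ^ 3 := by gcongr
        _ = 1 / 27 := by norm_num
    have h0 : 0 ≤ 0.22 - 0.17 * w - 1.037 * w ^ 2 - 1.013 * w ^ 3 := by linarith
    have h1 := mul_nonneg hw0 h0
    have : (1 - w) * (1 + 2.22 * w + 2.05 * w ^ 2 + 1.013 * w ^ 3) - (1 + w) =
       w * (0.22 - 0.17 * w - 1.037 * w ^ 2 - 1.013 * w ^ 3) := by ring
    linarith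
  have h3 : 0 ≤ 1 - w := by linarith
  exact t2.trans (mul_le_mul_of_nonneg_left t1 h3)

lemma cf_beta (x h d c b v X : ℝ) (hx : 0 < x) (hh : 0 < h) (hd : 3 * h < d) (hc : 0 < c) (hb : 0 < b)
    (hv : 1 ≤ v) (hX : 375000 ≤ X) (hcX : 30 * c * X < d)
    (h1 : |v - 1296 * x * c ^ 5 / (d ^ 3 * (d + 6 * c) ^ 3)| < h / d)
    (h2 : |v - 1296 * x * c ^ 5 / ((d + b) ^ 3 * ((d + b) + 6 * c) ^ 3)| < h / (d + b)) :
    b ≤ 0.371 * (h / v) := by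
  have hd0 : 0 < d := by linarith
  have hv0 : 0 < v := by linarith
  set w := h / (d * v) with hw
  have hw0 : 0 < w := by positivity
  have hw3 : w ≤ 1 / 3 := by
    rw [hw, div_le_div_iff₀ (by positivity) (by norm_num)]
    nlinarith
  have hwv : h / d = v * w := by rw [hw]; field_simp
  have h3 : h / (d + b) ≤ h / d := by
    apply div_le_div_of_nonneg_left hh.le hd0; linarith
  rw [abs_lt] at h1 h2
  set μ' := 1296 * x * c ^ 5 / ((d + b) ^ 3 * ((d + b) + 6 * c) ^ 3) with hμ'
  set R := (d + b) * (d + b + 6 * c) / (d * (d + 6 * c)) with hR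
  have hμ : 1296 * x * c ^ 5 / (d ^ 3 * (d + 6 * c) ^ 3) = μ' * R ^ 3 := by
    rw [hμ', hR]; field_simp
  rw [hμ] at h1
  have hμ'1 : v * (1 - w) < μ' := by nlinarith
  have hμ'2 : μ' * R ^ 3 < v * (1 + w) := by nlinarith
  by_contra hcon
  push Not at hcon
  have he : d + 6 * c ≤ 1.000001 * d := by nlinarith
  have hβ : 0.37 * w * d * 1.000001 ≤ b := by
    have : w * d = h / v := by rw [hw]; field_simp
    have : 0 < h / v := by positivity
    nlinarith
  have r1 : (1 + 0.37 * w) * d ≤ d + b := by nlinarith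
  have r2 : (1 + 0.37 * w) * (d + 6 * c) ≤ d + b + 6 * c := by nlinarith
  have hR2 : (1 + 0.37 * w) ^ 2 ≤ R := by
    rw [hR, le_div_iff₀ (by positivity)]
    calc (1 + 0.37 * w) ^ 2 * (d * (d + 6 * c)) = ((1 + 0.37 * w) * d) * ((1 + 0.37 * w) * (d + 6 * c)) := by ring
      _ ≤ _ := by gcongr
  have hR3 : (1 + 0.37 * w) ^ 6 ≤ R ^ 3 := by
    calc (1 + 0.37 * w) ^ 6 = ((1 + 0.37 * w) ^ 2) ^ 3 := by ring
      _ ≤ _ := by gcongr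
  have hpoly : 1 + w ≤ (1 - w) * (1 + 0.37 * w) ^ 6 := cf_poly w hw0.le hw3
  have hR0 : 0 < R ^ 3 := by positivity
  have : v * (1 + w) ≤ v * (1 - w) * R ^ 3 := by
    have : (1 - w) * (1 + 0.37 * w) ^ 6 ≤ (1 - w) * R ^ 3 := by
      apply mul_le_mul_of_nonneg_left hR3; linarith
    rw [mul_assoc]
    apply mul_le_mul_of_nonneg_left _ hv0.le
    linarith
  nlinarith

lemma cf_Eident (d c f : ℝ) (hd : 0 < d) (hc : 0 < c) (hf : 0 < f) :
    (f - c) * (2 * c + 2 * f - d) / d ^ 3 + (f + c) * (d + 8 * c - 2 * f) / (d + 6 * c) ^ 3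
     - (f + c) * (d + 8 * f - 2 * c) / (d + 6 * f) ^ 3 + (f - c) * (d + 8 * c + 8 * f) / (d + 6 * c + 6 * f) ^ 3
    = 2592 * c * f * (2 * d + 6 * c + 6 * f) *
      (f ^ 4 * (((d + 6 * c) * (d + 6 * c + 6 * f)) ^ 2 + ((d + 6 * c) * (d + 6 * c + 6 * f)) * (d * (d + 6 * f)) + (d * (d + 6 * f)) ^ 2)
       - c ^ 4 * (((d + 6 * f) * (d + 6 * c + 6 * f)) ^ 2 + ((d + 6 * f) * (d + 6 * c + 6 * f)) * (d * (d + 6 * c)) + (d * (d + 6 * c)) ^ 2))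
      / (d * (d + 6 * c) * (d + 6 * f) * (d + 6 * c + 6 * f)) ^ 3 := by
  have h1 : d + 6 * c ≠ 0 := by positivity
  have h2 : d + 6 * f ≠ 0 := by positivity
  have h3 : d + 6 * c + 6 * f ≠ 0 := by positivity
  have h0 : d ≠ 0 := hd.ne'
  generalize hp : d + 6 * c = p at *
  generalize hq : d + 6 * f = q at *
  generalize hr : p + 6 * f = r at *
  rw [eq_div_iff (by positivity)]
  field_simp
  subst hr hq hp
  ring

lemma cf_frac_le (d p q : ℝ) (hd : 0 < d) (hq : 0 ≤ q) (hp : p ≤ d + 18 * q) :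
    p / (d + 6 * q) ^ 3 ≤ 1 / d ^ 2 := by
  rw [div_le_div_iff₀ (by positivity) (by positivity)]
  have : 0 ≤ 108 * d * q ^ 2 + 216 * q ^ 3 := by positivity
  have : 0 < d ^ 2 := by positivity
  nlinarith

lemma cf_Ebd (d c f main : ℝ) (hd0 : 0 < d) (hc : 0 < c) (hf0 : 0 < f) (hfc : 2 * c ≤ f) (hfd : f ≤ 0.0207 * d)
    (hmain2 : main = 2592 * c * f * (2 * d + 6 * c + 6 * f) *
      (f ^ 4 * (((d + 6 * c) * (d + 6 * c + 6 * f)) ^ 2 + ((d + 6 * c) * (d + 6 * c + 6 * f)) * (d * (d + 6 * f)) + (d * (d + 6 * f)) ^ 2)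
       - c ^ 4 * (((d + 6 * f) * (d + 6 * c + 6 * f)) ^ 2 + ((d + 6 * f) * (d + 6 * c + 6 * f)) * (d * (d + 6 * c)) + (d * (d + 6 * c)) ^ 2))
      / (d * (d + 6 * c) * (d + 6 * f) * (d + 6 * c + 6 * f)) ^ 3) :
    1000 * c * f ^ 5 / d ^ 7 ≤ main ∧ main ≤ 15552 * c * f ^ 5 / d ^ 7 := by
  set p := d + 6 * c with hp
  set q := d + 6 * f with hq
  set r := p + 6 * f with hr
  have hpd : d ≤ p := by linarith
  have hqd : d ≤ q := by linarith
  have hrd : d ≤ r := by linarith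
  have hpu : p ≤ 1.1 * d := by linarith
  have hqu : q ≤ 1.2 * d := by linarith
  have hru : r ≤ 1.2 * d := by linarith
  have hp0 : 0 < p := by linarith
  have hq0 : 0 < q := by linarith
  have hr0 : 0 < r := by linarith
  set s := 2 * d + 6 * c + 6 * f with hs
  have hs0 : 0 < s := by positivity
  set Mq := (p * r) ^ 2 + (p * r) * (d * q) + (d * q) ^ 2 with hMq
  set Nq := (q * r) ^ 2 + (q * r) * (d * p) + (d * p) ^ 2 with hNq
  -- upper bound
  have up : main ≤ 15552 * c * f ^ 5 / d ^ 7 := by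
    have hdq : d * q ≤ p * r := by
      have : p * r = d * q + (12 * (c * d) + 36 * (c * c) + 36 * (c * f)) := by rw [hr, hp, hq]; ring
      have : 0 < 12 * (c * d) + 36 * (c * c) + 36 * (c * f) := by positivity
      linarith
    have u1 : Mq ≤ 3 * (p * r) ^ 2 := by
      have t0 : 0 ≤ d * q := by positivity
      have t1 : (d * q) ^ 2 ≤ (p * r) ^ 2 := by gcongr
      have t2 : (p * r) * (d * q) ≤ (p * r) * (p * r) := by gcongr
      rw [hMq]; linarith
    have u2 : f ^ 4 * Mq - c ^ 4 * Nq ≤ f ^ 4 * (3 * (p * r) ^ 2) := by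
      have : 0 ≤ c ^ 4 * Nq := by positivity
      have : f ^ 4 * Mq ≤ f ^ 4 * (3 * (p * r) ^ 2) := by gcongr
      linarith
    have u3 : s * d ≤ 2 * (p * r) := by
      have t1 : d * r ≤ p * r := by gcongr
      have t2 : p * d ≤ p * r := by gcongr
      have t3 : s ≤ p + r := by rw [hs, hr, hp]; linarith
      have t4 : s * d ≤ (p + r) * d := by gcongr
      linarith
    rw [hmain2, div_le_div_iff₀ (by positivity) (by positivity)]
    calc 2592 * c * f * s * (f ^ 4 * Mq - c ^ 4 * Nq) * d ^ 7
        ≤ 2592 * c * f * s * (f ^ 4 * (3 * (p * r) ^ 2)) * d ^ 7 := by gcongr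
      _ = 7776 * c * f ^ 5 * (p * r) ^ 2 * (s * d) * (d * d) ^ 3 := by ring
      _ ≤ 7776 * c * f ^ 5 * (p * r) ^ 2 * (2 * (p * r)) * (d * q) ^ 3 := by gcongr
      _ = 15552 * c * f ^ 5 * (d * p * q * r) ^ 3 := by ring
  -- lower bound
  have low : 1000 * c * f ^ 5 / d ^ 7 ≤ main := by
    have l1 : 3 * d ^ 4 ≤ Mq := by
      have t1 : d * d ≤ p * r := by gcongr
      have t2 : d * d ≤ d * q := by gcongr
      calc 3 * d ^ 4 = (d * d) ^ 2 + (d * d) * (d * d) + (d * d) ^ 2 := by ring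
        _ ≤ Mq := by rw [hMq]; gcongr
    have l2 : Nq ≤ 8 * d ^ 4 := by
      calc Nq ≤ ((1.2 * d) * (1.2 * d)) ^ 2 + ((1.2 * d) * (1.2 * d)) * (d * (1.1 * d)) + (d * (1.1 * d)) ^ 2 := by
            rw [hNq]; gcongr
        _ = (1.2 ^ 4 + 1.2 ^ 2 * 1.1 + 1.1 ^ 2) * d ^ 4 := by ring
        _ ≤ 8 * d ^ 4 := by gcongr; norm_num
    have l3 : 16 * c ^ 4 ≤ f ^ 4 := by
      calc 16 * c ^ 4 = (2 * c) ^ 4 := by ring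
        _ ≤ f ^ 4 := by gcongr
    have l4 : 2.5 * f ^ 4 * d ^ 4 ≤ f ^ 4 * Mq - c ^ 4 * Nq := by
      have t1 : f ^ 4 * (3 * d ^ 4) ≤ f ^ 4 * Mq := by gcongr
      have t2 : c ^ 4 * Nq ≤ (f ^ 4 / 16) * (8 * d ^ 4) := by
        have : c ^ 4 ≤ f ^ 4 / 16 := by linarith
        gcongr
      linarith
    have l5 : (d * p * q * r) ^ 3 ≤ 4.2 * d ^ 12 := by
      calc (d * p * q * r) ^ 3 ≤ (d * (1.1 * d) * (1.2 * d) * (1.2 * d)) ^ 3 := by gcongr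
        _ = (1.1 * 1.2 * 1.2) ^ 3 * d ^ 12 := by ring
        _ ≤ 4.2 * d ^ 12 := by gcongr; norm_num
    have l6 : 2 * d ≤ s := by linarith
    rw [hmain2, div_le_div_iff₀ (by positivity) (by positivity)]
    calc 1000 * c * f ^ 5 * (d * p * q * r) ^ 3 ≤ 1000 * c * f ^ 5 * (4.2 * d ^ 12) := by gcongr
      _ ≤ 12960 * c * f ^ 5 * d ^ 12 := by
        have : 0 < c * f ^ 5 * d ^ 12 := by positivity
        nlinarith
      _ = 2592 * c * f * (2 * d) * (2.5 * f ^ 4 * d ^ 4) * d ^ 7 := by ring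
      _ ≤ _ := by
        have : 0 ≤ f ^ 4 * Mq - c ^ 4 * Nq := le_trans (by positivity) l4
        gcongr
  exact ⟨low, up⟩

lemma cf_E (x h d c f m1 m2 m3 m4 : ℝ) (E : ℤ) (hx : 0 < x) (hh : 0 < h) (hd : 3 * h < d) (hc : 0 < c)
    (hfc : 2 * c ≤ f) (hfh : f ≤ 0.062 * h)
    (hE : (E : ℝ) = (f - c) * (2 * c + 2 * f - d) * m1 + (f + c) * (d + 8 * c - 2 * f) * m2
      - (f + c) * (d + 8 * f - 2 * c) * m3 + (f - c) * (d + 8 * c + 8 * f) * m4)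
    (h1 : x < m1 * d ^ 3 ∧ m1 * d ^ 3 ≤ x + h)
    (h2 : x < m2 * (d + 6 * c) ^ 3 ∧ m2 * (d + 6 * c) ^ 3 ≤ x + h)
    (h3 : x < m3 * (d + 6 * f) ^ 3 ∧ m3 * (d + 6 * f) ^ 3 ≤ x + h)
    (h4 : x < m4 * (d + 6 * c + 6 * f) ^ 3 ∧ m4 * (d + 6 * c + 6 * f) ^ 3 ≤ x + h)
    (hxc : d ^ 6 ≤ 1944 * x * c ^ 5) :
    0.98 * d ^ 7 ≤ 15552 * x * c * f ^ 5 := by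
  have hd0 : 0 < d := by linarith
  have hf0 : 0 < f := by linarith
  have hfd : f ≤ 0.0207 * d := by linarith
  set W1 := (f - c) * ((d - 2 * c - 2 * f) / d ^ 3) with hW1
  set W2 := (f + c) * ((d + 8 * c - 2 * f) / (d + 6 * c) ^ 3) with hW2
  set W3 := (f + c) * ((d + 8 * f - 2 * c) / (d + 6 * f) ^ 3) with hW3
  set W4 := (f - c) * ((d + 8 * c + 8 * f) / (d + 6 * c + 6 * f) ^ 3) with hW4
  have i1 : 0 ≤ d - 2 * c - 2 * f := by linarith
  have i2 : 0 ≤ d + 8 * c - 2 * f := by linarith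
  have i3 : 0 ≤ d + 8 * f - 2 * c := by linarith
  have i4 : 0 ≤ f - c := by linarith
  have W1p : 0 ≤ W1 := by positivity
  have W2p : 0 ≤ W2 := by positivity
  have W3p : 0 ≤ W3 := by positivity
  have W4p : 0 ≤ W4 := by positivity
  have W1u : W1 ≤ (f - c) * (1 / d ^ 2) := by
    have := cf_frac_le d (d - 2 * c - 2 * f) 0 hd0 le_rfl (by linarith)
    simp only [mul_zero, add_zero] at this
    exact mul_le_mul_of_nonneg_left this i4
  have W2u : W2 ≤ (f + c) * (1 / d ^ 2) :=
    mul_le_mul_of_nonneg_left (cf_frac_le d _ c hd0 hc.le (by linarith)) (by linarith)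
  have W3u : W3 ≤ (f + c) * (1 / d ^ 2) :=
    mul_le_mul_of_nonneg_left (cf_frac_le d _ f hd0 hf0.le (by linarith)) (by linarith)
  have W4u : W4 ≤ (f - c) * (1 / d ^ 2) := by
    have := cf_frac_le d (d + 8 * c + 8 * f) (c + f) hd0 (by linarith) (by linarith)
    rw [show d + 6 * (c + f) = d + 6 * c + 6 * f by ring] at this
    exact mul_le_mul_of_nonneg_left this i4
  have hEW : (E : ℝ) = -W1 * (m1 * d ^ 3) + W2 * (m2 * (d + 6 * c) ^ 3) - W3 * (m3 * (d + 6 * f) ^ 3)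
      + W4 * (m4 * (d + 6 * c + 6 * f) ^ 3) := by
    have e1 : W1 * (m1 * d ^ 3) = (f - c) * (d - 2 * c - 2 * f) * m1 := by rw [hW1]; field_simp
    have e2 : W2 * (m2 * (d + 6 * c) ^ 3) = (f + c) * (d + 8 * c - 2 * f) * m2 := by rw [hW2]; field_simp
    have e3 : W3 * (m3 * (d + 6 * f) ^ 3) = (f + c) * (d + 8 * f - 2 * c) * m3 := by rw [hW3]; field_simp
    have e4 : W4 * (m4 * (d + 6 * c + 6 * f) ^ 3) = (f - c) * (d + 8 * c + 8 * f) * m4 := by rw [hW4]; field_simp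
    rw [hE, neg_mul, e1, e2, e3, e4]; ring
  set main := -W1 + W2 - W3 + W4 with hmain
  have lo : x * main - 2 * f * h * (1 / d ^ 2) ≤ E := by
    have a1 : W1 * (m1 * d ^ 3) ≤ W1 * (x + h) := mul_le_mul_of_nonneg_left h1.2 W1p
    have a2 : W2 * x ≤ W2 * (m2 * (d + 6 * c) ^ 3) := mul_le_mul_of_nonneg_left h2.1.le W2p
    have a3 : W3 * (m3 * (d + 6 * f) ^ 3) ≤ W3 * (x + h) := mul_le_mul_of_nonneg_left h3.2 W3p
    have a4 : W4 * x ≤ W4 * (m4 * (d + 6 * c + 6 * f) ^ 3) := mul_le_mul_of_nonneg_left h4.1.le W4p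
    have a5 : (W1 + W3) * h ≤ (2 * f * (1 / d ^ 2)) * h := by
      apply mul_le_mul_of_nonneg_right _ hh.le; linarith
    rw [hEW, hmain]; linarith
  have hi : (E : ℝ) ≤ x * main + 2 * f * h * (1 / d ^ 2) := by
    have a1 : W1 * x ≤ W1 * (m1 * d ^ 3) := mul_le_mul_of_nonneg_left h1.1.le W1p
    have a2 : W2 * (m2 * (d + 6 * c) ^ 3) ≤ W2 * (x + h) := mul_le_mul_of_nonneg_left h2.2 W2p
    have a3 : W3 * x ≤ W3 * (m3 * (d + 6 * f) ^ 3) := mul_le_mul_of_nonneg_left h3.1.le W3p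
    have a4 : W4 * (m4 * (d + 6 * c + 6 * f) ^ 3) ≤ W4 * (x + h) := mul_le_mul_of_nonneg_left h4.2 W4p
    have a5 : (W2 + W4) * h ≤ (2 * f * (1 / d ^ 2)) * h := by
      apply mul_le_mul_of_nonneg_right _ hh.le; linarith
    rw [hEW, hmain]; linarith
  obtain ⟨low, up⟩ := cf_Ebd d c f main hd0 hc hf0 hfc hfd (by
    rw [← cf_Eident d c f hd0 hc hf0, hmain, hW1, hW2, hW3, hW4]; ring)
  clear_value main
  clear hEW hE W1u W2u W3u W4u W1p W2p W3p W4p h1 h2 h3 h4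
  have hEpos : (0:ℝ) < E := by
    have k1 : 2 * f * h * (1 / d ^ 2) < x * (1000 * c * f ^ 5 / d ^ 7) := by
      rw [mul_one_div, ← mul_div_assoc, div_lt_div_iff₀ (by positivity) (by positivity)]
      have t3 : 16 * c ^ 4 ≤ f ^ 4 := by
        calc 16 * c ^ 4 = (2 * c) ^ 4 := by ring
          _ ≤ f ^ 4 := by gcongr
      calc 2 * f * h * d ^ 7 = 2 * f * d * h * d ^ 6 := by ring
        _ ≤ 2 * f * d * h * (1944 * x * c ^ 5) := by gcongr
        _ = (1944 * 2 * f * d * x * c * c ^ 4) * h := by ring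
        _ < (1944 * 2 * f * d * x * c * c ^ 4) * d := by
            apply mul_lt_mul_of_pos_left _ (by positivity); linarith
        _ = 243 * (f * d ^ 2 * x * c) * (16 * c ^ 4) := by ring
        _ ≤ 1000 * (f * d ^ 2 * x * c) * (f ^ 4) := by gcongr; norm_num
        _ = x * (1000 * c * f ^ 5) * d ^ 2 := by ring
    have k2 := mul_le_mul_of_nonneg_left low hx.le
    linarith
  have hE1 : (1:ℝ) ≤ E := by
    have : 0 < E := by exact_mod_cast hEpos
    exact_mod_cast this
  have k3 : 2 * f * h * (1 / d ^ 2) ≤ 0.02 := by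
    rw [mul_one_div, div_le_iff₀ (by positivity)]
    have : f * h ≤ 0.062 * h * h := by gcongr
    nlinarith
  have k4 := mul_le_mul_of_nonneg_left up hx.le
  have k5 : 0.98 ≤ x * (15552 * c * f ^ 5 / d ^ 7) := by linarith
  rw [← mul_div_assoc, le_div_iff₀ (by positivity)] at k5
  linarith

lemma cf_mu_bounds (x h d c v X : ℝ) (hx : 0 < x) (hh : 0 < h) (hd : 3 * h < d) (hc : 0 < c) (hv : 1 ≤ v)
    (hcX : 30 * c * X < d)
    (h1 : |v - 1296 * x * c ^ 5 / (d ^ 3 * (d + 6 * c) ^ 3)| < h / d) :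
    v * d ^ 6 ≤ 1944 * x * c ^ 5 ∧ (375000 ≤ X → 972 * x * c ^ 5 ≤ 1.000004 * v * d ^ 6) := by
  have hd0 : 0 < d := by linarith
  have h3 : h / d < 1 / 3 := by
    rw [div_lt_div_iff₀ hd0 (by norm_num)]; linarith
  set μ := 1296 * x * c ^ 5 / (d ^ 3 * (d + 6 * c) ^ 3) with hμ
  have hμe : μ * (d ^ 3 * (d + 6 * c) ^ 3) = 1296 * x * c ^ 5 := by
    rw [hμ]; field_simp
  rw [abs_lt] at h1
  have l1 : 2 / 3 * v ≤ μ := by linarith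
  have l2 : μ ≤ 4 / 3 * v := by linarith
  have hμ0 : 0 < μ := by positivity
  constructor
  · have : d ^ 6 ≤ d ^ 3 * (d + 6 * c) ^ 3 := by
      calc d ^ 6 = d ^ 3 * d ^ 3 := by ring
        _ ≤ _ := by gcongr; linarith
    have h5 : (2 / 3 * v) * d ^ 6 ≤ μ * (d ^ 3 * (d + 6 * c) ^ 3) := by gcongr
    linarith
  · intro hX
    have he : d + 6 * c ≤ 1.000001 * d := by nlinarith
    have : d ^ 3 * (d + 6 * c) ^ 3 ≤ 1.000004 * d ^ 6 := by
      calc d ^ 3 * (d + 6 * c) ^ 3 ≤ d ^ 3 * (1.000001 * d) ^ 3 := by gcongr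
        _ = 1.000001 ^ 3 * d ^ 6 := by ring
        _ ≤ _ := by gcongr; norm_num
    have h5 : μ * (d ^ 3 * (d + 6 * c) ^ 3) ≤ (4 / 3 * v) * (1.000004 * d ^ 6) := by gcongr
    linarith

lemma cf_cv (x h d c v X L : ℝ) (hX0 : 0 < X) (hxX : x = X ^ 7) (hL : 0 < L) (hhL : h = 5 * L * X)
    (hd : 3 * h < d) (hc : 0 < c) (hv : 1 ≤ v)
    (hcX : 30 * c * X < d)
    (h1 : |v - 1296 * x * c ^ 5 / (d ^ 3 * (d + 6 * c) ^ 3)| < h / d) :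
    375000 * (c * v) ≤ X ∧ v * (15 * L) ^ 6 ≤ 1944 * X * c ^ 5 := by
  have hx : 0 < x := by rw [hxX]; positivity
  have hh : 0 < h := by rw [hhL]; positivity
  have h2 := (cf_mu_bounds x h d c v X hx hh hd hc hv hcX h1).1
  have hv0 : 0 < v := by linarith
  constructor
  · have h3 : v * (30 * c * X) ^ 6 ≤ v * d ^ 6 := by gcongr
    have h4 : (1944 * c ^ 5 * X ^ 6) * (375000 * (c * v)) ≤ (1944 * c ^ 5 * X ^ 6) * X := by
      rw [hxX] at h2
      calc (1944 * c ^ 5 * X ^ 6) * (375000 * (c * v)) = v * (30 * c * X) ^ 6 := by ring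
        _ ≤ 1944 * X ^ 7 * c ^ 5 := h3.trans h2
        _ = _ := by ring
    exact le_of_mul_le_mul_left h4 (by positivity)
  · have h3 : v * (15 * L * X) ^ 6 ≤ v * d ^ 6 := by
      have : 15 * L * X ≤ d := by rw [hhL] at hd; linarith
      gcongr
    have h4 : X ^ 6 * (v * (15 * L) ^ 6) ≤ X ^ 6 * (1944 * X * c ^ 5) := by
      rw [hxX] at h2
      calc X ^ 6 * (v * (15 * L) ^ 6) = v * (15 * L * X) ^ 6 := by ring
        _ ≤ 1944 * X ^ 7 * c ^ 5 := h3.trans h2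
        _ = _ := by ring
    exact le_of_mul_le_mul_left h4 (by positivity)

lemma cf_pair (x h d c f v X m1 m2 m3 m4 : ℝ) (E : ℤ) (hx : 0 < x) (hh : 0 < h) (hd : 3 * h < d) (hc : 0 < c)
    (hv : 1 ≤ v) (hX : 375000 ≤ X) (hcX : 30 * c * X < d) (hfc : 2 * c ≤ f)
    (hE : (E : ℝ) = (f - c) * (2 * c + 2 * f - d) * m1 + (f + c) * (d + 8 * c - 2 * f) * m2
      - (f + c) * (d + 8 * f - 2 * c) * m3 + (f - c) * (d + 8 * c + 8 * f) * m4)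
    (h1 : x < m1 * d ^ 3 ∧ m1 * d ^ 3 ≤ x + h)
    (h2 : x < m2 * (d + 6 * c) ^ 3 ∧ m2 * (d + 6 * c) ^ 3 ≤ x + h)
    (h3 : x < m3 * (d + 6 * f) ^ 3 ∧ m3 * (d + 6 * f) ^ 3 ≤ x + h)
    (h4 : x < m4 * (d + 6 * c + 6 * f) ^ 3 ∧ m4 * (d + 6 * c + 6 * f) ^ 3 ≤ x + h)
    (k1 : |v - 1296 * x * c ^ 5 / (d ^ 3 * (d + 6 * c) ^ 3)| < h / d)
    (k2 : |v - 1296 * x * c ^ 5 / ((d + 6 * f) ^ 3 * ((d + 6 * f) + 6 * c) ^ 3)| < h / (d + 6 * f)) :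
    1.83 * c ^ 5 * X ≤ v * f ^ 5 := by
  have hd0 : 0 < d := by linarith
  have hf0 : 0 < f := by linarith
  have hv0 : 0 < v := by linarith
  have hb := cf_beta x h d c (6 * f) v X hx hh hd hc (by linarith) hv hX hcX k1 k2
  have hhv : h / v ≤ h := div_le_self hh.le hv
  obtain ⟨b1, b2⟩ := cf_mu_bounds x h d c v X hx hh hd hc hv hcX k1
  have b2 := b2 hX
  have b3 : d ^ 6 ≤ 1944 * x * c ^ 5 := by
    have : 1 * d ^ 6 ≤ v * d ^ 6 := by gcongr
    linarith
  have hE2 := cf_E x h d c f m1 m2 m3 m4 E hx hh hd hc hfc (by linarith) hE h1 h2 h3 h4 b3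
  have s1 : 0.98 * (30 * c * X) * (972 * x * c ^ 5) ≤ 15552 * x * c * f ^ 5 * (1.000004 * v) := by
    calc 0.98 * (30 * c * X) * (972 * x * c ^ 5) ≤ 0.98 * (30 * c * X) * (1.000004 * v * d ^ 6) := by gcongr
      _ ≤ 0.98 * d * (1.000004 * v * d ^ 6) := by gcongr
      _ = 0.98 * d ^ 7 * (1.000004 * v) := by ring
      _ ≤ 15552 * x * c * f ^ 5 * (1.000004 * v) := by gcongr
  have s2 : (x * c) * (1.8375 * c ^ 5 * X) ≤ (x * c) * (1.000004 * v * f ^ 5) := by linarith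
  have s3 := le_of_mul_le_mul_left s2 (by positivity)
  have : 0 < c ^ 5 * X := by positivity
  nlinarith

/-- fifth root -/
noncomputable def cfr (t : ℝ) : ℝ := t ^ ((1:ℝ) / 5)

lemma cfr_pow (t : ℝ) (ht : 0 ≤ t) : cfr t ^ 5 = t := by
  rw [cfr, ← Real.rpow_natCast, ← Real.rpow_mul ht]; norm_num
lemma cfr_nonneg (t : ℝ) (ht : 0 ≤ t) : 0 ≤ cfr t := Real.rpow_nonneg ht _
lemma cfr_pos (t : ℝ) (ht : 0 < t) : 0 < cfr t := Real.rpow_pos_of_pos ht _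
lemma cfr_mono {s t : ℝ} (hs : 0 ≤ s) (h : s ≤ t) : cfr s ≤ cfr t :=
  Real.rpow_le_rpow hs h (by norm_num)
lemma cfr_mul {s t : ℝ} (hs : 0 ≤ s) (ht : 0 ≤ t) : cfr (s * t) = cfr s * cfr t :=
  Real.mul_rpow hs ht
lemma cfr_le {s t : ℝ} (hs : 0 ≤ s) (ht : 0 ≤ t) (h : s ≤ t ^ 5) : cfr s ≤ t := by
  by_contra hc
  push Not at hc
  have : t ^ 5 < cfr s ^ 5 := by gcongr
  rw [cfr_pow s hs] at this
  linarith
lemma le_cfr {s t : ℝ} (hs : 0 ≤ s) (h : t ^ 5 ≤ s) : t ≤ cfr s := by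
  by_contra hc
  push Not at hc
  have h0 := cfr_nonneg s hs
  have : cfr s ^ 5 < t ^ 5 := by gcongr
  rw [cfr_pow s hs] at this
  linarith

lemma cf_pq (p q : ℝ) (hq : 0 ≤ q) (hqp : q ≤ p) (hp : 0 < p) (h : p ^ 5 = q ^ 5 + 1) :
    1 / p ^ 4 ≤ 5 * (p - q) := by
  rw [div_le_iff₀ (by positivity)]
  have h1 : (p - q) * (p ^ 4 + p ^ 3 * q + p ^ 2 * q ^ 2 + p * q ^ 3 + q ^ 4) = 1 := by
    linear_combination h
  have h2 : p ^ 4 + p ^ 3 * q + p ^ 2 * q ^ 2 + p * q ^ 3 + q ^ 4 ≤ 5 * p ^ 4 := by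
    calc p ^ 4 + p ^ 3 * q + p ^ 2 * q ^ 2 + p * q ^ 3 + q ^ 4 
      ≤ p ^ 4 + p ^ 3 * p + p ^ 2 * p ^ 2 + p * p ^ 3 + p ^ 4 := by gcongr
      _ = _ := by ring
  have h3 := mul_le_mul_of_nonneg_left h2 (sub_nonneg.2 hqp)
  linarith

lemma cf_sum_v (V : ℝ) (S : Finset ℕ) (hS : ∀ v ∈ S, 1 ≤ v ∧ (v:ℝ) ≤ V) (hV : 0 ≤ V) :
    ∑ v ∈ S, 1 / cfr v ^ 4 ≤ 5 * cfr V := by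
  have h1 : ∀ n : ℕ, ∑ v ∈ Finset.range n, 1 / cfr ((v + 1 : ℕ) : ℝ) ^ 4 ≤ 5 * cfr n := by
    intro n
    induction n with
    | zero => simp; exact cfr_nonneg 0 le_rfl
    | succ n ih =>
      rw [Finset.sum_range_succ]
      have hn : (0:ℝ) ≤ n := Nat.cast_nonneg n
      have hn1 : (0:ℝ) ≤ ((n + 1 : ℕ) : ℝ) := Nat.cast_nonneg _
      have := cf_pq (cfr ((n + 1 : ℕ) : ℝ)) (cfr n) (cfr_nonneg _ hn) (cfr_mono hn (by push_cast; linarith))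
        (cfr_pos _ (by push_cast; linarith)) (by
          rw [cfr_pow _ hn, cfr_pow _ hn1]; push_cast; ring)
      linarith
  have h2 : S ⊆ (Finset.range ⌊V⌋₊).image (fun v : ℕ => v + 1) := by
    intro v hv
    obtain ⟨a, b⟩ := hS v hv
    rw [Finset.mem_image]
    have := Nat.le_floor b
    exact ⟨v - 1, Finset.mem_range.2 (by omega), by omega⟩
  have h4 : ∑ v ∈ S, 1 / cfr v ^ 4 ≤ ∑ v ∈ ((Finset.range ⌊V⌋₊).image (fun v : ℕ => v + 1) : Finset ℕ), 1 / cfr v ^ 4 :=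
    Finset.sum_le_sum_of_subset_of_nonneg h2 (fun v _ _ => by
      have := cfr_nonneg v (Nat.cast_nonneg v)
      positivity)
  rw [Finset.sum_image (by intro a _ b _ h; simpa using h)] at h4
  have h5 := h1 ⌊V⌋₊
  have h6 := cfr_mono (Nat.cast_nonneg _) (Nat.floor_le hV)
  linarith

lemma cf_sum_c (n : ℕ) (hn : 1 ≤ n) (S : Finset ℕ) (hS : ∀ c ∈ S, n < c) :
    ∑ c ∈ S, 1 / cfr c ^ 6 ≤ 5 / cfr n := by
  have h1 : ∀ N : ℕ, ∑ j ∈ Finset.range N, 1 / cfr ((n + 1 + j : ℕ) : ℝ) ^ 6 ≤ 5 / cfr n - 5 / cfr ((n + N : ℕ) : ℝ) := by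
    intro N
    induction N with
    | zero => simp
    | succ N ih =>
      rw [Finset.sum_range_succ]
      have hn : (0:ℝ) < ((n + N : ℕ) : ℝ) := by exact_mod_cast (by omega)
      have hn1 : (0:ℝ) < ((n + 1 + N : ℕ) : ℝ) := by exact_mod_cast (by omega)
      have e : n + (N + 1) = n + 1 + N := by ring
      rw [e]
      have hle : ((n + N : ℕ) : ℝ) ≤ ((n + 1 + N : ℕ) : ℝ) := by exact_mod_cast (by omega)
      have hq := cfr_pos _ hn
      have hp := cfr_pos _ hn1
      have hqp := cfr_mono hn.le hle
      have key := cf_pq _ _ hq.le hqp hp (by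
          rw [cfr_pow _ hn.le, cfr_pow _ hn1.le]; push_cast; ring)
      set p := cfr ((n + 1 + N : ℕ) : ℝ)
      set q := cfr ((n + N : ℕ) : ℝ)
      have : 1 / p ^ 6 ≤ 5 / q - 5 / p := by
        calc 1 / p ^ 6 = (1 / p ^ 4) / (p * p) := by field_simp
          _ ≤ (5 * (p - q)) / (p * p) := by gcongr
          _ ≤ (5 * (p - q)) / (q * p) := by
              apply div_le_div_of_nonneg_left (by linarith) (by positivity)
              gcongr
          _ = 5 / q - 5 / p := by field_simp
      linarith
  have h2 : S ⊆ (Finset.range (S.sup id)).image (fun j : ℕ => n + 1 + j) := by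
    intro c hc
    have a := hS c hc
    have b := Finset.le_sup (f := id) hc
    simp only [id] at b
    rw [Finset.mem_image]
    exact ⟨c - (n + 1), Finset.mem_range.2 (by omega), by omega⟩
  have h4 : ∑ c ∈ S, 1 / cfr c ^ 6 ≤ ∑ c ∈ ((Finset.range (S.sup id)).image (fun j : ℕ => n + 1 + j) : Finset ℕ), 1 / cfr c ^ 6 :=
    Finset.sum_le_sum_of_subset_of_nonneg h2 (fun v _ _ => by
      have := cfr_nonneg v (Nat.cast_nonneg v)
      positivity)
  rw [Finset.sum_image (by intro a _ b _ h; simp at h; omega)] at h4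
  have h5 := h1 (S.sup id)
  have h6 : 0 ≤ 5 / cfr ((n + S.sup id : ℕ) : ℝ) := by
    have := cfr_nonneg ((n + S.sup id : ℕ) : ℝ) (Nat.cast_nonneg _)
    positivity
  linarith

lemma cf_fib (Γ : Finset (ℕ × ℕ)) (F : ℕ → ℕ → ℝ) :
    ∑ g ∈ Γ, F g.1 g.2 = ∑ c ∈ Γ.image Prod.fst,
      ∑ v ∈ (Γ.filter (fun g => g.1 = c)).image Prod.snd, F c v := by
  classical
  rw [← Finset.sum_fiberwise_of_maps_to (s := Γ) (t := Γ.image Prod.fst) (g := Prod.fst)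
    (fun g hg => Finset.mem_image_of_mem _ hg)]
  apply Finset.sum_congr rfl
  intro c _
  rw [Finset.sum_image]
  · apply Finset.sum_congr rfl
    intro g hg
    rw [(Finset.mem_filter.1 hg).2]
  · intro a ha b hb hab
    have h1 := (Finset.mem_filter.1 ha).2
    have h2 := (Finset.mem_filter.1 hb).2
    exact Prod.ext (h1.trans h2.symm) hab

lemma cf_group_card (X L : ℝ) (hX : 375000 ≤ X) (hlog : Real.log X ≤ L / 7)
    (Γ : Finset (ℕ × ℕ)) (hΓ : ∀ g ∈ Γ, 1 ≤ g.1 ∧ 1 ≤ g.2 ∧ 375000 * ((g.1:ℝ) * g.2) ≤ X) :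
    (Γ.card : ℝ) ≤ X / 375000 * (1 + L / 7) := by
  classical
  have h0 : (Γ.card : ℝ) = ∑ g ∈ Γ, (fun _ _ => 1 : ℕ → ℕ → ℝ) g.1 g.2 := by simp
  refine le_of_eq_of_le (h0.trans (cf_fib Γ (fun _ _ => 1 : ℕ → ℕ → ℝ))) ?_
  set Y := X / 375000 with hY
  have hY1 : 1 ≤ Y := by rw [hY, le_div_iff₀ (by norm_num)]; linarith
  have hin : ∀ c ∈ Γ.image Prod.fst, ∑ v ∈ (Γ.filter (fun g => g.1 = c)).image Prod.snd, (1:ℝ) ≤ Y * (c:ℝ)⁻¹ := by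
    intro c hc
    obtain ⟨g0, hg0, rfl⟩ := Finset.mem_image.1 hc
    have hc1 := (hΓ g0 hg0).1
    have hcpos : (0:ℝ) < g0.1 := by exact_mod_cast hc1
    have hsub : (Γ.filter (fun g => g.1 = g0.1)).image Prod.snd ⊆ Finset.Icc 1 ⌊Y * (g0.1:ℝ)⁻¹⌋₊ := by
      intro v hv
      obtain ⟨g, hg, rfl⟩ := Finset.mem_image.1 hv
      obtain ⟨hg1, hg2⟩ := Finset.mem_filter.1 hg
      obtain ⟨a, b, e⟩ := hΓ g hg1
      rw [Finset.mem_Icc]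
      refine ⟨b, Nat.le_floor ?_⟩
      rw [hg2] at e
      rw [← div_eq_mul_inv, le_div_iff₀ hcpos, hY, le_div_iff₀ (by norm_num)]
      linarith
    have := Finset.card_le_card hsub
    rw [Nat.card_Icc] at this
    rw [Finset.sum_const, nsmul_eq_mul, mul_one]
    have h2 : (((Γ.filter (fun g => g.1 = g0.1)).image Prod.snd).card : ℝ) ≤ (⌊Y * (g0.1:ℝ)⁻¹⌋₊ : ℝ) := by
      exact_mod_cast (by omega)
    exact h2.trans (Nat.floor_le (by positivity))
  refine (Finset.sum_le_sum hin).trans ?_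
  rw [← Finset.mul_sum]
  apply mul_le_mul_of_nonneg_left _ (by linarith)
  have h1 := harmonic_floor_le_one_add_log Y hY1
  have h2 : Real.log Y ≤ L / 7 := by
    refine le_trans (Real.log_le_log (by linarith) ?_) hlog
    rw [hY]; apply div_le_self <;> linarith
  have h3 : ((harmonic ⌊Y⌋₊ : ℚ) : ℝ) = ∑ c ∈ Finset.Icc 1 ⌊Y⌋₊, (c:ℝ)⁻¹ := by
    rw [harmonic_eq_sum_Icc]; push_cast; rfl
  have h4 : ∑ c ∈ Γ.image Prod.fst, (c:ℝ)⁻¹ ≤ ∑ c ∈ Finset.Icc 1 ⌊Y⌋₊, (c:ℝ)⁻¹ := by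
    apply Finset.sum_le_sum_of_subset_of_nonneg
    · intro c hc
      obtain ⟨g, hg, rfl⟩ := Finset.mem_image.1 hc
      obtain ⟨a, b, e⟩ := hΓ g hg
      rw [Finset.mem_Icc]
      refine ⟨a, Nat.le_floor ?_⟩
      rw [hY, le_div_iff₀ (by norm_num)]
      have hb : (1:ℝ) ≤ g.2 := by exact_mod_cast b
      have ha : (1:ℝ) ≤ g.1 := by exact_mod_cast a
      nlinarith
    · intro c _ _; positivity
  rw [h3] at h1
  linarith

lemma cf_group_sum (X L : ℝ) (hX : 375000 ≤ X) (hL : 89 ≤ L)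
    (Γ : Finset (ℕ × ℕ)) (hΓ : ∀ g ∈ Γ, 1 ≤ g.1 ∧ 1 ≤ g.2 ∧ 375000 * ((g.1:ℝ) * g.2) ≤ X ∧
      (g.2:ℝ) * (15 * L) ^ 6 ≤ 1944 * X * (g.1:ℝ) ^ 5) :
    ∑ g ∈ Γ, 1 / ((g.1:ℝ) * cfr g.2 ^ 4) ≤ 2.66 * (cfr X / cfr L) := by
  classical
  have h0 : ∑ g ∈ Γ, 1 / ((g.1:ℝ) * cfr g.2 ^ 4) =
      ∑ g ∈ Γ, (fun c v => 1 / ((c:ℝ) * cfr v ^ 4) : ℕ → ℕ → ℝ) g.1 g.2 := by simp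
  refine le_of_eq_of_le (h0.trans (cf_fib Γ (fun c v => 1 / ((c:ℝ) * cfr v ^ 4) : ℕ → ℕ → ℝ))) ?_
  have hX0 : 0 < X := by linarith
  have hL0 : 0 < L := by linarith
  have hρX := cfr_pos X hX0
  have hρL := cfr_pos L hL0
  have hL5 := cfr_pow L hL0.le
  set n := ⌊L / 2⌋₊ with hn
  have hn1 : 0.4887 * L ≤ n := by
    have := Nat.lt_floor_add_one (L / 2)
    rw [← hn] at this
    linarith
  have hn2 : (n:ℝ) ≤ L / 2 := Nat.floor_le (by linarith)
  set C := Γ.image Prod.fst with hC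
  set Sc : ℕ → Finset ℕ := fun c => (Γ.filter (fun g => g.1 = c)).image Prod.snd with hSc
  have hmem : ∀ c ∈ C, 1 ≤ c := by
    intro c hc
    obtain ⟨g, hg, rfl⟩ := Finset.mem_image.1 hc
    exact (hΓ g hg).1
  have hSmem : ∀ c, ∀ v ∈ Sc c, 1 ≤ v ∧ 375000 * ((c:ℝ) * v) ≤ X ∧
      (v:ℝ) * (15 * L) ^ 6 ≤ 1944 * X * (c:ℝ) ^ 5 := by
    intro c v hv
    obtain ⟨g, hg, rfl⟩ := Finset.mem_image.1 hv
    obtain ⟨hg1, rfl⟩ := Finset.mem_filter.1 hg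
    exact (hΓ g hg1).2
  have hin1 : ∀ c ∈ C, ∑ v ∈ Sc c, 1 / ((c:ℝ) * cfr v ^ 4) ≤ 0.882 * (cfr X / (L * cfr L)) := by
    intro c hc
    have hc1 : (1:ℝ) ≤ c := by exact_mod_cast hmem c hc
    set V := 1944 * X * (c:ℝ) ^ 5 / (15 * L) ^ 6 with hV
    have hV0 : 0 ≤ V := by positivity
    have := cf_sum_v V (Sc c) (fun v hv => by
      obtain ⟨a, _, b⟩ := hSmem c v hv
      refine ⟨a, ?_⟩
      rw [hV, le_div_iff₀ (by positivity)]; exact b) hV0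
    have hVr : cfr V ≤ 0.1764 * c * (cfr X / (L * cfr L)) := by
      apply cfr_le hV0 (by positivity)
      rw [mul_pow, mul_pow, div_pow, mul_pow, cfr_pow X hX0.le, hL5, hV]
      rw [mul_div_assoc', div_le_div_iff₀ (by positivity) (by positivity)]
      have : 0 < X * (c:ℝ) ^ 5 * L ^ 6 := by positivity
      nlinarith
    have e : ∑ v ∈ Sc c, 1 / ((c:ℝ) * cfr v ^ 4) = (1 / (c:ℝ)) * ∑ v ∈ Sc c, 1 / cfr v ^ 4 := by
      rw [Finset.mul_sum]; apply Finset.sum_congr rfl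
      intro v _; rw [one_div_mul_one_div]
    rw [e]
    calc (1 / (c:ℝ)) * ∑ v ∈ Sc c, 1 / cfr v ^ 4 ≤ (1 / (c:ℝ)) * (5 * (0.1764 * c * (cfr X / (L * cfr L)))) := by
          gcongr; linarith
      _ = _ := by field_simp; norm_num
  have hin2 : ∀ c ∈ C, ∑ v ∈ Sc c, 1 / ((c:ℝ) * cfr v ^ 4) ≤ 0.384 * cfr X * (1 / cfr c ^ 6) := by
    intro c hc
    have hc1 : (1:ℝ) ≤ c := by exact_mod_cast hmem c hc
    have hc0 : (0:ℝ) < c := by linarith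
    have hρc := cfr_pos c hc0
    have hc5 := cfr_pow c hc0.le
    set V := X / (375000 * c) with hV
    have hV0 : 0 ≤ V := by positivity
    have := cf_sum_v V (Sc c) (fun v hv => by
      obtain ⟨a, b, _⟩ := hSmem c v hv
      refine ⟨a, ?_⟩
      rw [hV, le_div_iff₀ (by positivity)]; linarith) hV0
    have hVr : cfr V ≤ 0.0768 * (cfr X / cfr c) := by
      apply cfr_le hV0 (by positivity)
      rw [mul_pow, div_pow, cfr_pow X hX0.le, hc5, hV]
      rw [mul_div_assoc', div_le_div_iff₀ (by positivity) (by positivity)]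
      have : 0 < X * (c:ℝ) := by positivity
      nlinarith
    have e : ∑ v ∈ Sc c, 1 / ((c:ℝ) * cfr v ^ 4) = (1 / (c:ℝ)) * ∑ v ∈ Sc c, 1 / cfr v ^ 4 := by
      rw [Finset.mul_sum]; apply Finset.sum_congr rfl
      intro v _; rw [one_div_mul_one_div]
    rw [e]
    calc (1 / (c:ℝ)) * ∑ v ∈ Sc c, 1 / cfr v ^ 4 ≤ (1 / (c:ℝ)) * (5 * (0.0768 * (cfr X / cfr c))) := by
          gcongr; linarith
      _ = (1 / (cfr c ^ 5)) * (5 * (0.0768 * (cfr X / cfr c))) := by rw [hc5]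
      _ = _ := by field_simp; norm_num
  rw [← Finset.sum_filter_add_sum_filter_not C (fun c => c ≤ n)]
  have hA : ∑ c ∈ C.filter (fun c => c ≤ n), ∑ v ∈ Sc c, 1 / ((c:ℝ) * cfr v ^ 4) ≤ 0.441 * (cfr X / cfr L) := by
    have hcard : ((C.filter (fun c => c ≤ n)).card : ℝ) ≤ L / 2 := by
      have : C.filter (fun c => c ≤ n) ⊆ Finset.Icc 1 n := by
        intro c hc
        obtain ⟨a, b⟩ := Finset.mem_filter.1 hc
        exact Finset.mem_Icc.2 ⟨hmem c a, b⟩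
      have := Finset.card_le_card this
      rw [Nat.card_Icc] at this
      have : ((C.filter (fun c => c ≤ n)).card : ℝ) ≤ n := by exact_mod_cast (by omega)
      linarith
    calc _ ≤ ∑ c ∈ C.filter (fun c => c ≤ n), 0.882 * (cfr X / (L * cfr L)) :=
          Finset.sum_le_sum (fun c hc => hin1 c (Finset.mem_filter.1 hc).1)
      _ = ((C.filter (fun c => c ≤ n)).card : ℝ) * (0.882 * (cfr X / (L * cfr L))) := by
          rw [Finset.sum_const, nsmul_eq_mul]
      _ ≤ (L / 2) * (0.882 * (cfr X / (L * cfr L))) := by gcongr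
      _ = _ := by field_simp; norm_num
  have hB : ∑ c ∈ C.filter (fun c => ¬ c ≤ n), ∑ v ∈ Sc c, 1 / ((c:ℝ) * cfr v ^ 4) ≤ 2.216 * (cfr X / cfr L) := by
    have hnp : (0:ℝ) < n := by linarith
    have hnr : 0.8665 * cfr L ≤ cfr n := by
      apply le_cfr hnp.le
      rw [mul_pow, hL5]
      nlinarith
    have hs := cf_sum_c n (by exact_mod_cast hnp) (C.filter (fun c => ¬ c ≤ n)) (fun c hc => by
      have := (Finset.mem_filter.1 hc).2; omega)
    calc _ ≤ ∑ c ∈ C.filter (fun c => ¬ c ≤ n), 0.384 * cfr X * (1 / cfr c ^ 6) :=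
          Finset.sum_le_sum (fun c hc => hin2 c (Finset.mem_filter.1 hc).1)
      _ = 0.384 * cfr X * ∑ c ∈ C.filter (fun c => ¬ c ≤ n), 1 / cfr c ^ 6 := by rw [Finset.mul_sum]
      _ ≤ 0.384 * cfr X * (5 / cfr n) := by gcongr
      _ ≤ 0.384 * cfr X * (5 / (0.8665 * cfr L)) := by gcongr
      _ = (0.384 * 5 / 0.8665) * (cfr X / cfr L) := by field_simp
      _ ≤ _ := by gcongr; norm_num
  have : 0 < cfr X / cfr L := by positivity
  linarith

lemma cf_sum_c5 (M : ℕ) : ∑ c ∈ Finset.Icc 1 M, 1 / (c:ℝ) ^ 5 ≤ 1.125 := by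
  have h : ∀ M : ℕ, ∑ c ∈ Finset.Icc 1 (M + 1), 1 / (c:ℝ) ^ 5 ≤ 1.125 - 1 / (8 * ((M:ℝ) + 1) ^ 2) := by
    intro M
    induction M with
    | zero => norm_num
    | succ M ih =>
      rw [Finset.sum_Icc_succ_top (by omega)]
      have hM : (0:ℝ) ≤ M := Nat.cast_nonneg M
      have : 1 / (((M + 1 + 1 : ℕ) : ℝ)) ^ 5 ≤ 1 / (8 * ((M:ℝ) + 1) ^ 2) - 1 / (8 * (((M + 1 : ℕ):ℝ) + 1) ^ 2) := by
        push_cast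
        set n : ℝ := (M:ℝ) + 1 with hn
        have hn1 : 1 ≤ n := by rw [hn]; linarith
        rw [div_sub_div _ _ (by positivity) (by positivity), div_le_div_iff₀ (by positivity) (by positivity)]
        have e : (1 * (8 * (n + 1) ^ 2) - 8 * n ^ 2 * 1) * (n + 1) ^ 5 = (n + 1) ^ 2 * (8 * (2 * n + 1) * (n + 1) ^ 3) := by ring
        have e2 : 1 * (8 * n ^ 2 * (8 * (n + 1) ^ 2)) = (n + 1) ^ 2 * (64 * n ^ 2) := by ring
        rw [e, e2]
        apply mul_le_mul_of_nonneg_left _ (by positivity)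
        have : 0 ≤ n - 1 := by linarith
        have : (n + 1) ^ 3 ≥ n ^ 3 + 3 * n ^ 2 + 4 := by nlinarith
        have t : 8 * (2 * n + 1) * (n + 1) ^ 3 ≥ 8 * (2 * n + 1) * (n ^ 3 + 3 * n ^ 2 + 4) := by gcongr
        have : n ^ 3 ≥ n ^ 2 := by nlinarith
        have : n ^ 4 ≥ n ^ 2 := by nlinarith
        nlinarith
      linarith
  cases M with
  | zero => norm_num
  | succ M =>
    have := h M
    have : 0 ≤ 1 / (8 * ((M:ℝ) + 1) ^ 2) := by positivity
    linarith [h M]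

def cfHit (x h : ℝ) (d m : ℕ) : Prop := x < m * (d:ℝ) ^ 3 ∧ m * (d:ℝ) ^ 3 ≤ x + h

def cfF (d c m n : ℕ) : ℤ :=
  (m : ℤ) * ((d:ℤ) ^ 2 - 3 * d * c + 6 * c ^ 2) - n * ((d:ℤ) ^ 2 + 15 * d * c + 60 * c ^ 2)

lemma cfF_bd (x h : ℝ) (d c m n : ℕ) (hh : 0 < h) (hd : 0 < d) (hc : 1 ≤ c) (h2 : 2 * c ≤ d)
    (hm : cfHit x h d m) (hn : cfHit x h (d + 6 * c) n) :
    |(cfF d c m n : ℝ) - 1296 * x * (c:ℝ) ^ 5 / ((d:ℝ) ^ 3 * ((d:ℝ) + 6 * c) ^ 3)| < h / d := by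
  obtain ⟨a1, a2⟩ := hm
  obtain ⟨b1, b2⟩ := hn
  push_cast at b1 b2
  have := cf_F x h d c m n hh (by exact_mod_cast hd) (by exact_mod_cast hc) (by exact_mod_cast h2) a1 a2 b1 b2
  rw [cfF]; push_cast; exact this

lemma cf_big (x h X : ℝ) (hX : 0 < X) (hx : 0 ≤ x) (hh : 0 < h) (B : Finset ℕ)
    (hB : ∀ d ∈ B, 3 * h < d ∧ ∃ m, cfHit x h d m)
    (hsp : ∀ d ∈ B, ∀ e ∈ B, d < e → (d:ℝ) + d / (5 * X) ≤ e) :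
    (B.card : ℝ) ≤ 1 + max (Real.log (x + h) / 3 - Real.log (3 * h)) 0 * (1 + 5 * X) := by
  have := cf_spacing1 B (fun d => Real.log d) (1 / (1 + 5 * X)) (Real.log (3 * h)) (Real.log (x + h) / 3)
    (by positivity) (fun d hd => by
      obtain ⟨h1, m, h2, h3⟩ := hB d hd
      have hd0 : (0:ℝ) < d := by linarith
      refine ⟨Real.log_le_log (by linarith) h1.le, ?_⟩
      have hm : m ≠ 0 := by
        rintro rfl
        simp at h2; linarith
      have hm1 : (1:ℝ) ≤ m := by exact_mod_cast Nat.one_le_iff_ne_zero.2 hm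
      have h4 : (d:ℝ) ^ 3 ≤ x + h := by
        have : 0 < (d:ℝ) ^ 3 := by positivity
        nlinarith
      have := Real.log_le_log (by positivity) h4
      rw [Real.log_pow] at this
      push_cast at this
      linarith) (fun d hd e he hde => by
      have hd0 : (0:ℝ) < d := by linarith [(hB d hd).1]
      have h1 := hsp d hd e he hde
      have he0 : (0:ℝ) < e := by linarith [(hB e he).1]
      change 1 / (1 + 5 * X) ≤ Real.log (e:ℝ) - Real.log (d:ℝ)
      rw [← Real.log_div he0.ne' hd0.ne']
      have h2 : 1 + 1 / (5 * X) ≤ (e:ℝ) / d := by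
        rw [le_div_iff₀ hd0]
        calc (1 + 1 / (5 * X)) * (d:ℝ) = d + d / (5 * X) := by ring
          _ ≤ e := h1
      have h3 := Real.log_le_log (by positivity) h2
      have h4 := Real.one_sub_inv_le_log_of_pos (x := 1 + 1 / (5 * X)) (by positivity)
      have h5 : 1 - (1 + 1 / (5 * X))⁻¹ = 1 / (1 + 5 * X) := by
        field_simp
        ring
      linarith)
  rw [div_div_eq_mul_div, div_one] at this
  exact this

lemma cf_zero (x h X : ℝ) (hX : 72 ≤ X) (hxh : 10000 * h ≤ x) (hh : 1 ≤ h) (B : Finset ℕ) (c m n : ℕ → ℕ)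
    (hB : ∀ d ∈ B, d.Prime ∧ 3 * h < d ∧ 1 ≤ c d ∧ 30 * (c d : ℝ) * X < d ∧ cfHit x h d (m d) ∧
      cfHit x h (d + 6 * c d) (n d) ∧ cfF d (c d) (m d) (n d) = 0) :
    (B.card : ℝ) ≤ 1.125 * (h / 80) := by
  classical
  have hx : 0 < x := by linarith
  have hk : ∀ d, ∃ k : ℕ, d ∈ B → 1 ≤ k ∧ 16 * m d = (d ^ 2 + 15 * d * c d + 60 * c d ^ 2) * k ∧
      (k:ℝ) * (c d : ℝ) ^ 5 < h / 80 := by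
    intro d
    by_cases hd : d ∈ B
    swap
    · exact ⟨0, fun h => absurd h hd⟩
    obtain ⟨a1, a2, a3, a4, a5, a6, a7⟩ := hB d hd
    have hc1 : (1:ℝ) ≤ c d := by exact_mod_cast a3
    have hcd : 2 * (c d:ℝ) ≤ d := by nlinarith
    have hcdn : 2 * c d ≤ d := by exact_mod_cast hcd
    have hd3 : 3 < d := by
      have : (3:ℝ) < d := by linarith
      exact_mod_cast this
    have hd0 : (0:ℝ) < d := by linarith
    obtain ⟨k, hk⟩ := cf_dvd d (c d) (m d) (n d) a1 hd3 (by omega) (by omega) a7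
    have hk0 : k ≠ 0 := by
      rintro rfl
      have : m d = 0 := by omega
      have := a5.1
      rw [‹m d = 0›] at this
      simp at this; linarith
    have hb := cfF_bd x h d (c d) (m d) (n d) (by linarith) (by omega) a3 hcdn a5 a6
    rw [a7] at hb
    simp only [Int.cast_zero, zero_sub, abs_neg] at hb
    have hk1 : 1 ≤ k := Nat.one_le_iff_ne_zero.2 hk0
    have hkc := cf_kc5 x h d (c d) k (m d) X hx (by linarith) hd0 (by linarith) (by exact_mod_cast hk1) hX hxh a4
      (by exact_mod_cast hk) a5.2 (lt_of_le_of_lt (le_abs_self _) hb)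
    exact ⟨k, fun _ => ⟨hk1, hk, hkc⟩⟩
  choose k hk using hk
  set M := B.sup c with hM
  have hcard : B.card ≤ ((Finset.Icc 1 M).sigma (fun c => Finset.Icc 1 ⌊(h / 80) / (c:ℝ) ^ 5⌋₊)).card := by
    apply Finset.card_le_card_of_injOn (fun d => (⟨c d, k d⟩ : Σ _ : ℕ, ℕ))
    · intro d hd
      have hd : d ∈ B := hd
      obtain ⟨b1, b2, b3⟩ := hk d hd
      have a3 := (hB d hd).2.2.1
      have hc1 : (1:ℝ) ≤ c d := by exact_mod_cast a3
      simp only [Finset.coe_sigma, Set.mem_sigma_iff, Finset.mem_coe, Finset.mem_Icc]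
      refine ⟨⟨a3, Finset.le_sup (f := c) hd⟩, b1, Nat.le_floor ?_⟩
      rw [le_div_iff₀ (by positivity)]
      exact b3.le
    · have hmain : ∀ d ∈ B, ∀ e ∈ B, d < e → c d = c e → k d = k e → False := by
        intro d hd e he hlt hc hke
        obtain ⟨b1, b2, b3⟩ := hk d hd
        obtain ⟨b1', b2', b3'⟩ := hk e he
        rw [← hc, ← hke] at b2'
        exact cf_uniq x h hh (k d) (c d) d e (m d) (m e) b1 hlt (hB d hd).2.1 b2 b2'
          (hB d hd).2.2.2.2.1.1 (hB e he).2.2.2.2.1.2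
      intro d hd e he heq
      have hd : d ∈ B := hd
      have he : e ∈ B := he
      simp only [Sigma.mk.injEq, heq_eq_eq] at heq
      rcases lt_trichotomy d e with h1 | h1 | h1
      · exact (hmain d hd e he h1 heq.1 heq.2).elim
      · exact h1
      · exact (hmain e he d hd h1 heq.1.symm heq.2.symm).elim
  rw [Finset.card_sigma] at hcard
  simp only [Nat.card_Icc, Nat.add_sub_cancel] at hcard
  calc (B.card : ℝ) ≤ ((∑ c ∈ Finset.Icc 1 M, ⌊(h / 80) / (c:ℝ) ^ 5⌋₊ : ℕ) : ℝ) := by exact_mod_cast hcard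
    _ = ∑ c ∈ Finset.Icc 1 M, (⌊(h / 80) / (c:ℝ) ^ 5⌋₊ : ℝ) := by push_cast; rfl
    _ ≤ ∑ c ∈ Finset.Icc 1 M, (h / 80) * (1 / (c:ℝ) ^ 5) := by
        apply Finset.sum_le_sum
        intro c _
        rw [mul_one_div]
        exact Nat.floor_le (by positivity)
    _ = (h / 80) * ∑ c ∈ Finset.Icc 1 M, 1 / (c:ℝ) ^ 5 := by rw [Finset.mul_sum]
    _ ≤ (h / 80) * 1.125 := by
        gcongr
        exact cf_sum_c5 M
    _ = _ := by ring

lemma cf_groups (x h X L : ℝ) (hX : 72 ≤ X) (hL : 0 < L) (hxX : x = X ^ 7) (hhL : h = 5 * L * X)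
    (hlog : Real.log X ≤ L / 7) (hXL : 375000 ≤ X → 89 ≤ L) (B : Finset ℕ) (c v m : ℕ → ℕ)
    (hB : ∀ d ∈ B, 3 * h < d ∧ 1 ≤ c d ∧ 1 ≤ v d ∧ 30 * (c d : ℝ) * X < d ∧ cfHit x h d (m d) ∧
      cfHit x h (d + 6 * c d) (m (d + 6 * c d)) ∧ cfF d (c d) (m d) (m (d + 6 * c d)) = v d)
    (hgap : ∀ d ∈ B, ∀ e ∈ B, d < e → d + 6 * c d ≤ e)
    (hmod : ∀ d ∈ B, ∀ e ∈ B, d % 6 = e % 6) :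
    B.card = 0 ∨ (375000 ≤ X ∧
      (B.card : ℝ) ≤ 2 * (X / 375000 * (1 + L / 7)) + 0.2919 * h / cfr L) := by
  classical
  rcases B.eq_empty_or_nonempty with hBe | hBne
  · left; rw [hBe]; simp
  right
  have hX0 : 0 < X := by linarith
  have hx : 0 < x := by rw [hxX]; positivity
  have hh : 0 < h := by rw [hhL]; positivity
  have hk : ∀ d ∈ B, |(v d : ℝ) - 1296 * x * (c d:ℝ) ^ 5 / ((d:ℝ) ^ 3 * ((d:ℝ) + 6 * c d) ^ 3)| < h / d := by
    intro d hd
    obtain ⟨a2, a3, a4, a5, a6, a7, a8⟩ := hB d hd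
    have hc1 : (1:ℝ) ≤ c d := by exact_mod_cast a3
    have hcd : 2 * (c d:ℝ) ≤ d := by nlinarith
    have hcdn : 2 * c d ≤ d := by exact_mod_cast hcd
    have hb := cfF_bd x h d (c d) (m d) _ hh (by omega) a3 hcdn a6 a7
    rw [a8] at hb
    exact_mod_cast hb
  set Γ := B.image (fun d => (c d, v d)) with hΓ
  have hΓm : ∀ g ∈ Γ, 1 ≤ g.1 ∧ 1 ≤ g.2 ∧ 375000 * ((g.1:ℝ) * g.2) ≤ X ∧
      (g.2:ℝ) * (15 * L) ^ 6 ≤ 1944 * X * (g.1:ℝ) ^ 5 := by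
    intro g hg
    obtain ⟨d, hd, rfl⟩ := Finset.mem_image.1 hg
    obtain ⟨a2, a3, a4, a5, a6, a7, a8⟩ := hB d hd
    have := cf_cv x h d (c d) (v d) X L hX0 hxX hL hhL a2 (by exact_mod_cast a3) (by exact_mod_cast a4) a5 (hk d hd)
    exact ⟨a3, a4, this⟩
  have hX3 : 375000 ≤ X := by
    obtain ⟨d, hd⟩ := hBne
    obtain ⟨a, b, e, _⟩ := hΓm (c d, v d) (Finset.mem_image_of_mem _ hd)
    have ha : (1:ℝ) ≤ c d := by exact_mod_cast a
    have hb : (1:ℝ) ≤ v d := by exact_mod_cast b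
    simp only [] at e
    nlinarith
  refine ⟨hX3, ?_⟩
  have hL89 := hXL hX3
  have hρX := cfr_pos X hX0
  have hρL := cfr_pos L hL
  -- fibers
  have hfib : ∀ g ∈ Γ, ((B.filter (fun d => (c d, v d) = g)).card : ℝ) ≤
      2 + 0.1097 * h / cfr X * (1 / ((g.1:ℝ) * cfr g.2 ^ 4)) := by
    rintro ⟨c0, v0⟩ hg
    obtain ⟨g1, g2, g3, g4⟩ := hΓm _ hg
    simp only [] at g1 g2 g3 g4 ⊢
    have hc0 : (1:ℝ) ≤ c0 := by exact_mod_cast g1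
    have hv0 : (1:ℝ) ≤ v0 := by exact_mod_cast g2
    have hv0p : (0:ℝ) < v0 := by linarith
    have hc0p : (0:ℝ) < c0 := by linarith
    have hρv := cfr_pos v0 hv0p
    have hv5 := cfr_pow v0 hv0p.le
    have hX5 := cfr_pow X hX0.le
    set Bg := B.filter (fun d => (c d, v d) = (c0, v0)) with hBg
    have hne : Bg.Nonempty := by
      obtain ⟨d, hd, he⟩ := Finset.mem_image.1 hg
      exact ⟨d, Finset.mem_filter.2 ⟨hd, he⟩⟩
    have hmem : ∀ d ∈ Bg, d ∈ B ∧ c d = c0 ∧ v d = v0 := by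
      intro d hd
      obtain ⟨a, b⟩ := Finset.mem_filter.1 hd
      simp only [Prod.mk.injEq] at b
      exact ⟨a, b⟩
    set d0 := Bg.min' hne with hd0
    have hd0m : d0 ∈ Bg := Finset.min'_mem _ _
    set g := 6 * ((c0:ℝ) * (1.128 * (cfr X / cfr v0))) with hgdef
    have hsp := cf_spacing2 Bg (fun d => (d:ℝ)) g d0 (d0 + 0.371 * (h / v0)) (by positivity)
      (fun d hd => by
        have hle : d0 ≤ d := Finset.min'_le _ _ hd
        refine ⟨by exact_mod_cast hle, ?_⟩
        rcases hle.eq_or_lt with heq | hlt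
        · rw [← heq]
          have : 0 ≤ 0.371 * (h / (v0:ℝ)) := by positivity
          linarith
        obtain ⟨u1, u2, u3⟩ := hmem d0 hd0m
        obtain ⟨w1, w2, w3⟩ := hmem d hd
        obtain ⟨a2, a3, a4, a5, a6, a7, a8⟩ := hB d0 u1
        have k1 := hk d0 u1
        have k2 := hk d w1
        rw [u2, u3] at k1
        rw [w2, w3] at k2
        rw [u2] at a5
        have hlt' : (d0:ℝ) < d := by exact_mod_cast hlt
        have e : (d:ℝ) = d0 + (d - d0) := by ring
        rw [e] at k2
        have := cf_beta x h d0 c0 (d - d0) v0 X hx hh a2 hc0p (by linarith) hv0 hX3 a5 k1 k2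
        linarith)
      (fun d _ e _ hde => by exact_mod_cast hde)
      (fun d hd u hu e he hdu hue => by
        obtain ⟨d1, d2, d3⟩ := hmem d hd
        obtain ⟨u1, u2, u3⟩ := hmem u hu
        obtain ⟨e1, e2, e3⟩ := hmem e he
        have gp1 := hgap d d1 u u1 hdu
        have gp2 := hgap u u1 e e1 hue
        rw [d2] at gp1
        rw [u2] at gp2
        obtain ⟨f, hf⟩ : ∃ f, e = d + 6 * f := by
          have := hmod d d1 e e1
          exact ⟨(e - d) / 6, by omega⟩
        have hfc : 2 * c0 ≤ f := by omega
        obtain ⟨a2, a3, a4, a5, a6, a7, a8⟩ := hB d d1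
        obtain ⟨b2, b3, b4, b5, b6, b7, b8⟩ := hB e e1
        have k1 := hk d d1
        have k2 := hk e e1
        rw [d2, d3] at k1
        rw [e2, e3] at k2
        rw [d2] at a5 a7
        rw [e2] at b7
        rw [hf] at k2 b6 b7
        have he' : d + 6 * f + 6 * c0 = d + 6 * c0 + 6 * f := by ring
        rw [he'] at b7
        unfold cfHit at a6 a7 b6 b7
        push_cast at k2 a7 b6 b7
        have hpair := cf_pair x h d c0 f v0 X (m d) (m (d + 6 * c0)) (m (d + 6 * f)) (m (d + 6 * c0 + 6 * f))
          (((f:ℤ) - c0) * (2 * c0 + 2 * f - d) * m d + (f + c0) * (d + 8 * c0 - 2 * f) * m (d + 6 * c0)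
            - (f + c0) * (d + 8 * f - 2 * c0) * m (d + 6 * f) + (f - c0) * (d + 8 * c0 + 8 * f) * m (d + 6 * c0 + 6 * f))
          hx hh a2 hc0p hv0 hX3 a5 (by exact_mod_cast hfc) (by push_cast; ring) a6 a7 b6 b7 k1 k2
        have hfle : (c0:ℝ) * (1.128 * (cfr X / cfr v0)) ≤ f := by
          have hf0 : (0:ℝ) ≤ f := Nat.cast_nonneg f
          by_contra hcon
          push Not at hcon
          have h5 : (f:ℝ) ^ 5 < ((c0:ℝ) * (1.128 * (cfr X / cfr v0))) ^ 5 := by gcongr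
          have h6 : ((c0:ℝ) * (1.128 * (cfr X / cfr v0))) ^ 5 = 1.128 ^ 5 * (c0:ℝ) ^ 5 * X / v0 := by
            rw [mul_pow, mul_pow, div_pow, hX5, hv5]; ring
          rw [h6, lt_div_iff₀ hv0p] at h5
          have h7 : 1.128 ^ 5 * (c0:ℝ) ^ 5 * X ≤ 1.83 * (c0:ℝ) ^ 5 * X := by
            gcongr; norm_num
          linarith
        rw [hf]; push_cast
        rw [hgdef]; linarith)
    rw [add_sub_cancel_left, max_eq_left (by positivity)] at hsp
    refine hsp.trans ?_
    have e1 : 2 * (0.371 * (h / (v0:ℝ)) / g) = (0.742 / 6.768) * h / cfr X * (1 / ((c0:ℝ) * cfr v0 ^ 4)) := by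
      rw [hgdef]
      have : (v0:ℝ) = cfr v0 * cfr v0 ^ 4 := by rw [← pow_succ', hv5]
      have e3 : h / (v0:ℝ) = h / (cfr v0 * cfr v0 ^ 4) := by rw [← this]
      rw [e3]
      field_simp
      norm_num
    rw [e1]
    have : (0.742 / 6.768) * h / cfr X * (1 / ((c0:ℝ) * cfr v0 ^ 4)) ≤ 0.1097 * h / cfr X * (1 / ((c0:ℝ) * cfr v0 ^ 4)) := by
      gcongr; norm_num
    linarith
  have hcardB : (B.card : ℝ) = ∑ g ∈ Γ, ((B.filter (fun d => (c d, v d) = g)).card : ℝ) := by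
    have := Finset.card_eq_sum_card_fiberwise (f := fun d => (c d, v d)) (s := B) (t := Γ)
      (fun d hd => Finset.mem_image_of_mem _ hd)
    rw [this]; push_cast; rfl
  rw [hcardB]
  refine (Finset.sum_le_sum hfib).trans ?_
  rw [Finset.sum_add_distrib, ← Finset.mul_sum, Finset.sum_const, nsmul_eq_mul]
  have s1 := cf_group_card X L hX3 hlog Γ (fun g hg => ⟨(hΓm g hg).1, (hΓm g hg).2.1, (hΓm g hg).2.2.1⟩)
  have s2 := cf_group_sum X L hX3 hL89 Γ hΓm
  have s3 : 0.1097 * h / cfr X * ∑ g ∈ Γ, 1 / ((g.1:ℝ) * cfr g.2 ^ 4) ≤ 0.1097 * h / cfr X * (2.66 * (cfr X / cfr L)) := by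
    gcongr
  have s4 : 0.1097 * h / cfr X * (2.66 * (cfr X / cfr L)) = (0.1097 * 2.66) * h / cfr L := by
    field_simp
  have s5 : (0.1097 * 2.66) * h / cfr L ≤ 0.2919 * h / cfr L := by gcongr; norm_num
  linarith

lemma cf_class (x h X L : ℝ) (hX : 72 ≤ X) (hL : 30 ≤ L) (hxX : x = X ^ 7) (hhL : h = 5 * L * X)
    (hxh : 10000 * h ≤ x)
    (hlog : Real.log X ≤ L / 7) (hXL : 375000 ≤ X → 89 ≤ L) (A : Finset ℕ) (r : ℕ)
    (hA : ∀ d ∈ A, d.Prime ∧ d % 6 = r ∧ 3 * h < d ∧ ∃ m, cfHit x h d m) (base Tv : ℝ)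
    (hbase : base = 2 + max (Real.log (x + h) / 3 - Real.log (3 * h)) 0 * (1 + 5 * X) + 1.125 * (h / 80))
    (hTv : Tv = 2 * (X / 375000 * (1 + L / 7)) + 0.2919 * h / cfr L) :
    (X < 375000 → (A.card : ℝ) ≤ base) ∧ (A.card : ℝ) ≤ base + Tv := by
  classical
  have hX0 : 0 < X := by linarith
  have hx : 0 < x := by rw [hxX]; positivity
  have hh : 1 ≤ h := by rw [hhL]; nlinarith
  have hm : ∀ d, ∃ m, d ∈ A → cfHit x h d m := by
    intro d
    by_cases hd : d ∈ A
    · obtain ⟨m, hm⟩ := (hA d hd).2.2.2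
      exact ⟨m, fun _ => hm⟩
    · exact ⟨0, fun h => absurd h hd⟩
  choose m hm using hm
  have hc : ∀ d, ∃ c, d ∈ A → (∃ e ∈ A, d < e) → 1 ≤ c ∧ d + 6 * c ∈ A ∧ ∀ e ∈ A, d < e → d + 6 * c ≤ e := by
    intro d
    by_cases hd : d ∈ A ∧ ∃ e ∈ A, d < e
    · obtain ⟨hdA, e, he, hde⟩ := hd
      have hne : (A.filter (fun e => d < e)).Nonempty := ⟨e, Finset.mem_filter.2 ⟨he, hde⟩⟩
      set e0 := (A.filter (fun e => d < e)).min' hne with he0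
      have he0m := Finset.min'_mem (A.filter (fun e => d < e)) hne
      rw [← he0] at he0m
      obtain ⟨q1, q2⟩ := Finset.mem_filter.1 he0m
      have r1 := (hA d hdA).2.1
      have r2 := (hA e0 q1).2.1
      have e6 : d + 6 * ((e0 - d) / 6) = e0 := by omega
      refine ⟨(e0 - d) / 6, fun _ _ => ⟨by omega, by rw [e6]; exact q1, fun e' he' hde' => ?_⟩⟩
      rw [e6]
      exact Finset.min'_le _ _ (Finset.mem_filter.2 ⟨he', hde'⟩)
    · exact ⟨0, fun h1 h2 => absurd ⟨h1, h2⟩ hd⟩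
  choose c hc using hc
  set A1 := A.filter (fun d => ∃ e ∈ A, d < e) with hA1
  set Al := A.filter (fun d => ¬ ∃ e ∈ A, d < e) with hAl
  have k1 : A1.card + Al.card = A.card := Finset.card_filter_add_card_filter_not _
  set Ab := A1.filter (fun d : ℕ => (d:ℝ) ≤ 30 * c d * X) with hAb
  set A2 := A1.filter (fun d : ℕ => ¬ (d:ℝ) ≤ 30 * c d * X) with hA2
  have k2 : Ab.card + A2.card = A1.card := Finset.card_filter_add_card_filter_not _
  set F : ℕ → ℤ := fun d => cfF d (c d) (m d) (m (d + 6 * c d)) with hF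
  set A0 := A2.filter (fun d => F d = 0) with hA0
  set Av := A2.filter (fun d => ¬ F d = 0) with hAv
  have k3 : A0.card + Av.card = A2.card := Finset.card_filter_add_card_filter_not _
  have hAlc : Al.card ≤ 1 := by
    rw [Finset.card_le_one]
    intro a ha b hb
    obtain ⟨a1, a2⟩ := Finset.mem_filter.1 ha
    obtain ⟨b1, b2⟩ := Finset.mem_filter.1 hb
    push Not at a2 b2
    exact le_antisymm (b2 a a1) (a2 b b1)
  have hAbc : (Ab.card : ℝ) ≤ 1 + max (Real.log (x + h) / 3 - Real.log (3 * h)) 0 * (1 + 5 * X) := by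
    apply cf_big x h X hX0 hx.le (by linarith)
    · intro d hd
      obtain ⟨d1, d2⟩ := Finset.mem_filter.1 hd
      have d3 := (Finset.mem_filter.1 d1).1
      exact (hA d d3).2.2
    · intro d hd e he hde
      obtain ⟨d1, d2⟩ := Finset.mem_filter.1 hd
      obtain ⟨d3, d4⟩ := Finset.mem_filter.1 d1
      have e3 := (Finset.mem_filter.1 (Finset.mem_filter.1 he).1).1
      have := (hc d d3 d4).2.2 e e3 hde
      have h1 : (d:ℝ) + 6 * c d ≤ e := by exact_mod_cast this
      have h2 : (d:ℝ) / (5 * X) ≤ 6 * c d := by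
        rw [div_le_iff₀ (by positivity)]; linarith
      linarith
  have hA2m : ∀ d ∈ A2, d ∈ A ∧ 3 * h < d ∧ 1 ≤ c d ∧ 30 * (c d : ℝ) * X < d ∧ cfHit x h d (m d) ∧
      cfHit x h (d + 6 * c d) (m (d + 6 * c d)) ∧ (∀ e ∈ A, d < e → d + 6 * c d ≤ e) := by
    intro d hd
    obtain ⟨d1, d2⟩ := Finset.mem_filter.1 hd
    obtain ⟨d3, d4⟩ := Finset.mem_filter.1 d1
    push Not at d2
    obtain ⟨p1, p2, p3⟩ := hc d d3 d4
    exact ⟨d3, (hA d d3).2.2.1, p1, d2, hm d d3, hm _ p2, p3⟩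
  have hA0c : (A0.card : ℝ) ≤ 1.125 * (h / 80) := by
    apply cf_zero x h X hX hxh hh A0 c m (fun d => m (d + 6 * c d))
    intro d hd
    obtain ⟨d1, d2⟩ := Finset.mem_filter.1 hd
    obtain ⟨q0, q1, q2, q3, q4, q5, q6⟩ := hA2m d d1
    exact ⟨(hA d q0).1, q1, q2, q3, q4, q5, d2⟩
  have hAvc := cf_groups x h X L hX (by linarith) hxX hhL hlog hXL Av c (fun d => (F d).toNat) m
    (by
      intro d hd
      obtain ⟨d1, d2⟩ := Finset.mem_filter.1 hd
      obtain ⟨q0, q1, q2, q3, q4, q5, q6⟩ := hA2m d d1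
      have hc1 : (1:ℝ) ≤ c d := by exact_mod_cast q2
      have hcd : 2 * (c d:ℝ) ≤ d := by nlinarith
      have hcdn : 2 * c d ≤ d := by exact_mod_cast hcd
      have hb := cfF_bd x h d (c d) (m d) _ (by linarith) (by omega) q2 hcdn q4 q5
      rw [abs_lt] at hb
      have hd0 : (0:ℝ) < d := by linarith
      have hμ : 0 ≤ 1296 * x * (c d:ℝ) ^ 5 / ((d:ℝ) ^ 3 * ((d:ℝ) + 6 * c d) ^ 3) := by positivity
      have h3 : h / d < 1 := by
        rw [div_lt_one hd0]; linarith
      have hF1 : (-1:ℝ) < (F d : ℝ) := by simp only [hF]; linarith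
      have hF2 : -1 < F d := by exact_mod_cast hF1
      have hF3 : 1 ≤ F d := by omega
      refine ⟨q1, q2, ?_, q3, q4, q5, ?_⟩
      · change 1 ≤ (F d).toNat
        omega
      · change F d = ((F d).toNat : ℤ)
        omega)
    (by
      intro d hd e he hde
      obtain ⟨q0, q1, q2, q3, q4, q5, q6⟩ := hA2m d (Finset.mem_filter.1 hd).1
      exact q6 e (hA2m e (Finset.mem_filter.1 he).1).1 hde)
    (by
      intro d hd e he
      rw [(hA d (hA2m d (Finset.mem_filter.1 hd).1).1).2.1, (hA e (hA2m e (Finset.mem_filter.1 he).1).1).2.1])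
  have htot : (A.card : ℝ) = A0.card + Av.card + Ab.card + Al.card := by
    rw [← k1, ← k2, ← k3]; push_cast; ring
  have hAlc' : (Al.card : ℝ) ≤ 1 := by exact_mod_cast hAlc
  have hTv0 : 0 ≤ Tv := by
    have := cfr_pos L (by linarith)
    rw [hTv]; positivity
  rw [← hTv] at hAvc
  constructor
  · intro hXlt
    rcases hAvc with h0 | ⟨h0, _⟩
    · have : (Av.card : ℝ) = 0 := by exact_mod_cast h0
      linarith
    · linarith
  · rcases hAvc with h0 | ⟨_, h0⟩
    · have : (Av.card : ℝ) = 0 := by exact_mod_cast h0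
      linarith
    · linarith

lemma cf_total (x h X L : ℝ) (hX : 72 ≤ X) (hL : 30 ≤ L) (hxX : x = X ^ 7) (hhL : h = 5 * L * X)
    (hxh : 10000 * h ≤ x)
    (hlog : Real.log X ≤ L / 7) (hXL : 375000 ≤ X → 89 ≤ L)
    (hno : ∀ n : ℕ, x < n → (n : ℝ) ≤ x + h → ∃ p : ℕ, p.Prime ∧ p ^ 3 ∣ n)
    (base Tv : ℝ)
    (hbase : base = 2 + max (Real.log (x + h) / 3 - Real.log (3 * h)) 0 * (1 + 5 * X) + 1.125 * (h / 80))
    (hTv : Tv = 2 * (X / 375000 * (1 + L / 7)) + 0.2919 * h / cfr L) :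
    ∃ N : ℝ, h - 1 ≤ 0.1755 * h + (h / 40 + 3 + Real.log 4 * (3 * h) / Real.log (3 * h / 40)) + 2 * N ∧
      (X < 375000 → N ≤ base) ∧ N ≤ base + Tv := by
  classical
  have hX0 : 0 < X := by linarith
  have hx : 0 < x := by rw [hxX]; positivity
  have hh : 10000 ≤ h := by rw [hhL]; nlinarith
  set P := (Finset.range (⌊x + h⌋₊ + 1)).filter (fun p => p.Prime ∧ ∃ m, cfHit x h p m) with hP
  have hPm : ∀ p ∈ P, p.Prime ∧ ∃ m, cfHit x h p m := fun p hp => (Finset.mem_filter.1 hp).2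
  have hmain := cf_count_main x h hx.le (by linarith) hno P (fun p hp => (hPm p hp).1) (by
    rintro p hp ⟨m, h1, h2⟩
    rw [hP, Finset.mem_filter, Finset.mem_range]
    refine ⟨Nat.lt_succ_of_le (Nat.le_floor ?_), hp, m, h1, h2⟩
    have hp1 : (1:ℝ) ≤ p := by exact_mod_cast hp.one_lt.le
    have hm : m ≠ 0 := by
      rintro rfl
      simp at h1; linarith
    have hm1 : (1:ℝ) ≤ m := by exact_mod_cast Nat.one_le_iff_ne_zero.2 hm
    have h3 : (p:ℝ) ≤ (p:ℝ) ^ 3 := le_self_pow₀ hp1 (by norm_num)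
    nlinarith)
  set Ps := P.filter (fun p : ℕ => (p:ℝ) ≤ 3 * h) with hPs
  set Pl := P.filter (fun p : ℕ => ¬ (p:ℝ) ≤ 3 * h) with hPl
  have k1 : Ps.card + Pl.card = P.card := Finset.card_filter_add_card_filter_not _
  have hs := cf_pi_bound Ps (fun p hp => (hPm p (Finset.mem_filter.1 hp).1).1) (3 * h) (3 * h / 40)
    (by linarith) (by linarith) (fun p hp => (Finset.mem_filter.1 hp).2)
  have hcl : ∀ r, (X < 375000 → ((Pl.filter (fun p => p % 6 = r)).card : ℝ) ≤ base) ∧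
      ((Pl.filter (fun p => p % 6 = r)).card : ℝ) ≤ base + Tv := by
    intro r
    apply cf_class x h X L hX hL hxX hhL hxh hlog hXL _ r _ base Tv hbase hTv
    intro d hd
    obtain ⟨d1, d2⟩ := Finset.mem_filter.1 hd
    obtain ⟨d3, d4⟩ := Finset.mem_filter.1 d1
    push Not at d4
    exact ⟨(hPm d d3).1, d2, d4, (hPm d d3).2⟩
  have hsub : Pl ⊆ Pl.filter (fun p => p % 6 = 1) ∪ Pl.filter (fun p => p % 6 = 5) := by
    intro p hp
    obtain ⟨d3, d4⟩ := Finset.mem_filter.1 hp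
    push Not at d4
    have hpp := (hPm p d3).1
    have hp3 : 3 < p := by
      have : (3:ℝ) < p := by linarith
      exact_mod_cast this
    have h2 : ¬ 2 ∣ p := fun hd => by
      have := (Nat.prime_dvd_prime_iff_eq Nat.prime_two hpp).1 hd; omega
    have h3 : ¬ 3 ∣ p := fun hd => by
      have := (Nat.prime_dvd_prime_iff_eq Nat.prime_three hpp).1 hd; omega
    have : p % 6 = 1 ∨ p % 6 = 5 := by omega
    rw [Finset.mem_union]
    rcases this with h6 | h6
    · exact Or.inl (Finset.mem_filter.2 ⟨hp, h6⟩)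
    · exact Or.inr (Finset.mem_filter.2 ⟨hp, h6⟩)
  have hc2 : Pl.card ≤ (Pl.filter (fun p => p % 6 = 1)).card + (Pl.filter (fun p => p % 6 = 5)).card :=
    (Finset.card_le_card hsub).trans (Finset.card_union_le _ _)
  have hc3 : (Pl.card : ℝ) ≤ (Pl.filter (fun p => p % 6 = 1)).card + (Pl.filter (fun p => p % 6 = 5)).card := by
    exact_mod_cast hc2
  obtain ⟨u1, u2⟩ := hcl 1
  obtain ⟨w1, w2⟩ := hcl 5
  refine ⟨(((Pl.filter (fun p => p % 6 = 1)).card : ℝ) + (Pl.filter (fun p => p % 6 = 5)).card) / 2, ?_, ?_, ?_⟩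
  · have : (P.card : ℝ) = Ps.card + Pl.card := by rw [← k1]; push_cast; ring
    linarith
  · intro hXX
    linarith [u1 hXX, w1 hXX]
  · linarith

lemma cf_log_lb (y : ℝ) (hy : 0 < y) (p q : ℕ) (hq : 0 < q) (h : (2.7182818286:ℝ) ^ p ≤ y ^ q) :
    (p:ℝ) / q ≤ Real.log y := by
  have hq' : (0:ℝ) < q := by exact_mod_cast hq
  rw [div_le_iff₀ hq', mul_comm, ← Real.log_pow, Real.le_log_iff_exp_le (by positivity)]
  have h1 : Real.exp p = Real.exp 1 ^ p := by rw [← Real.exp_nat_mul, mul_one]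
  rw [h1]
  exact (pow_le_pow_left₀ (Real.exp_pos 1).le Real.exp_one_lt_d9.le p).trans h

lemma cf_log_ub (y : ℝ) (hy : 0 < y) (p q : ℕ) (hq : 0 < q) (h : y ^ q ≤ (2.7182818283:ℝ) ^ p) :
    Real.log y ≤ (p:ℝ) / q := by
  have hq' : (0:ℝ) < q := by exact_mod_cast hq
  rw [le_div_iff₀ hq', mul_comm, ← Real.log_pow, Real.log_le_iff_le_exp (by positivity)]
  have h1 : Real.exp p = Real.exp 1 ^ p := by rw [← Real.exp_nat_mul, mul_one]
  rw [h1]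
  exact h.trans (pow_le_pow_left₀ (by norm_num) Real.exp_one_gt_d9.le p)

lemma cf_num (x h X L : ℝ) (hX : 72 ≤ X) (hL : 30 ≤ L) (hxX : x = X ^ 7) (hhL : h = 5 * L * X)
    (hxh : 10000 * h ≤ x) (hlog : Real.log X = L / 7) (base N : ℝ)
    (hbase : base = 2 + max (Real.log (x + h) / 3 - Real.log (3 * h)) 0 * (1 + 5 * X) + 1.125 * (h / 80))
    (hmain : h - 1 ≤ 0.1755 * h + (h / 40 + 3 + Real.log 4 * (3 * h) / Real.log (3 * h / 40)) + 2 * N)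
    (a la D q t : ℝ) (ha : 30 ≤ a) (haL : a ≤ L) (hla : la ≤ Real.log (15 * a)) (hla0 : 6 ≤ la)
    (hD0 : 0 ≤ D) (hD1 : D ≤ 0.1905)
    (hD : 4 / 21 * L - la ≤ D * L) (hq0 : 0 ≤ q) (hq : 4.1589 ≤ q * (la + a / 7 - 3.7))
    (hN : N ≤ base + t * h) (hfin : 0.228625 + q + 2 * D + 2 * t + 0.0022 < 1) : False := by
  have hX0 : 0 < X := by linarith
  have hx : 0 < x := by rw [hxX]; positivity
  have hh : 10000 ≤ h := by rw [hhL]; nlinarith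
  have hL0 : 0 < L := by linarith
  have hl15 : la ≤ Real.log (15 * L) := hla.trans (Real.log_le_log (by linarith) (by linarith))
  have hl3h : Real.log (3 * h) = Real.log (15 * L) + L / 7 := by
    rw [hhL, ← hlog, ← Real.log_mul (by positivity) (by positivity)]; congr 1; ring
  have hl40 : Real.log 40 ≤ 3.7 := by
    have := cf_log_ub 40 (by norm_num) 37 10 (by norm_num) (by norm_num)
    norm_num at this ⊢; exact this
  have hl4 : Real.log 4 ≤ 1.3863 := by
    have : Real.log 4 = 2 * Real.log 2 := by
      rw [show (4:ℝ) = 2 ^ 2 by norm_num, Real.log_pow]; norm_num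
    rw [this]; linarith [Real.log_two_lt_d9]
  have hl340 : la + a / 7 - 3.7 ≤ Real.log (3 * h / 40) := by
    rw [Real.log_div (by positivity) (by norm_num), hl3h]; linarith
  have hM : 0 < la + a / 7 - 3.7 := by linarith
  have hA : Real.log 4 * (3 * h) / Real.log (3 * h / 40) ≤ q * h := by
    rw [div_le_iff₀ (by linarith)]
    have h1 : q * (la + a / 7 - 3.7) ≤ q * Real.log (3 * h / 40) := mul_le_mul_of_nonneg_left hl340 hq0
    have h2 : Real.log 4 * 3 ≤ q * Real.log (3 * h / 40) := by linarith
    have h3 := mul_le_mul_of_nonneg_right h2 (by linarith : (0:ℝ) ≤ h)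
    linarith
  have hlx : Real.log (x + h) ≤ L + 0.0001 := by
    have h1 : x + h ≤ x * 1.0001 := by linarith
    have h2 : Real.log (x * 1.0001) = L + Real.log 1.0001 := by
      rw [Real.log_mul (by positivity) (by norm_num), hxX, Real.log_pow, hlog]; push_cast; ring
    have h3 : Real.log 1.0001 ≤ 1.0001 - 1 := Real.log_le_sub_one_of_pos (by norm_num)
    have h4 := Real.log_le_log (by positivity) h1
    linarith
  have hmax : max (Real.log (x + h) / 3 - Real.log (3 * h)) 0 ≤ D * L + 0.00004 := by
    apply max_le
    · rw [hl3h]; linarith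
    · positivity
  have hprod : max (Real.log (x + h) / 3 - Real.log (3 * h)) 0 * (1 + 5 * X) ≤ (D + 0.0006) * h := by
    have h1 := mul_le_mul_of_nonneg_right hmax (by positivity : (0:ℝ) ≤ 1 + 5 * X)
    have h2 : L * 360 ≤ h := by rw [hhL]; nlinarith
    have h3 : (1 + 5 * X) * 29 ≤ h := by rw [hhL]; nlinarith
    have h4 : (D * L + 0.00004) * (1 + 5 * X) = D * h + D * L + 0.00004 * (1 + 5 * X) := by
      rw [hhL]; ring
    have h5 : D * L ≤ 0.1905 * L := mul_le_mul_of_nonneg_right hD1 hL0.le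
    rw [h4] at h1
    linarith
  have hfin' : (0.228625 + q + 2 * D + 2 * t + 0.0022) * h < 1 * h := mul_lt_mul_of_pos_right hfin (by linarith)
  rw [hbase] at hN
  linarith

lemma cf_T (h X L : ℝ) (hX : 72 ≤ X) (hL : 30 ≤ L) (hhL : h = 5 * L * X) (Tv r t : ℝ)
    (hTv : Tv = 2 * (X / 375000 * (1 + L / 7)) + 0.2919 * h / cfr L) (hr0 : 0 < r) (hr : r ^ 5 ≤ L)
    (ht : 0.2919 ≤ (t - 0.00001) * r) : Tv ≤ t * h := by
  have hX0 : 0 < X := by linarith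
  have hh : 10000 ≤ h := by rw [hhL]; nlinarith
  have h1 : r ≤ cfr L := le_cfr (by linarith) hr
  have h2 : 0.2919 * h / cfr L ≤ (t - 0.00001) * h := by
    rw [div_le_iff₀ (by linarith)]
    have : 0 ≤ t - 0.00001 := by
      by_contra hc
      push Not at hc
      nlinarith
    have h3 := mul_le_mul_of_nonneg_left h1 this
    nlinarith
  have h3 : 2 * (X / 375000 * (1 + L / 7)) ≤ 0.00001 * h := by
    rw [hhL]; nlinarith [mul_pos hX0 (by linarith : 0 < L)]
  linarith

lemma cf_large (x : ℝ) (L h : ℝ) (hx : 0 < x) (hLx : L = Real.log x) (hL : 30 ≤ L)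
    (hh : h = 5 * x ^ ((1:ℝ)/7) * Real.log x)
    (hno : ∀ n : ℕ, x < n → (n : ℝ) ≤ x + h → ∃ p : ℕ, p.Prime ∧ p ^ 3 ∣ n) : False := by
  obtain ⟨X, hXd⟩ : ∃ X, X = x ^ ((1:ℝ)/7) := ⟨_, rfl⟩
  have hX0 : 0 < X := by rw [hXd]; positivity
  have hxX : x = X ^ 7 := by
    rw [hXd, ← Real.rpow_natCast, ← Real.rpow_mul hx.le]; norm_num
  have hlog : Real.log X = L / 7 := by
    rw [hXd, Real.log_rpow hx, ← hLx]; ring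
  have hhL : h = 5 * L * X := by rw [hh, ← hXd, ← hLx]; ring
  have hX : 72 ≤ X := by
    have h1 : Real.log 72 ≤ 30 / 7 := by
      have := cf_log_ub 72 (by norm_num) 30 7 (by norm_num) (by norm_num)
      norm_num at this ⊢; exact this
    exact (Real.log_le_log_iff (by norm_num) hX0).1 (by rw [hlog]; linarith)
  have hxh : 10000 * h ≤ x := by
    have h1 : L ≤ 7 * X := by
      have := Real.log_le_sub_one_of_pos hX0
      rw [hlog] at this; linarith
    have h2 : (72:ℝ) ^ 5 ≤ X ^ 5 := pow_le_pow_left₀ (by norm_num) hX 5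
    have h3 : h ≤ 35 * X ^ 2 := by rw [hhL]; nlinarith
    have h4 : x = X ^ 5 * X ^ 2 := by rw [hxX]; ring
    have h5 : (72:ℝ) ^ 5 * X ^ 2 ≤ X ^ 5 * X ^ 2 := mul_le_mul_of_nonneg_right h2 (by positivity)
    rw [h4]
    nlinarith [sq_nonneg X]
  have hXL : 375000 ≤ X → 89 ≤ L := by
    intro h1
    have h2 : (51:ℝ) / 4 ≤ Real.log 375000 := by
      have := cf_log_lb 375000 (by norm_num) 51 4 (by norm_num) (by norm_num)
      norm_num at this ⊢; exact this
    have h3 := Real.log_le_log (by norm_num) h1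
    rw [hlog] at h3; linarith
  have hXL2 : X < 375000 → L ≤ 91 := by
    intro h1
    have h2 : Real.log 375000 ≤ 13 := by
      have := cf_log_ub 375000 (by norm_num) 13 1 (by norm_num) (by norm_num)
      norm_num at this ⊢; exact this
    have h3 := Real.log_le_log hX0 h1.le
    rw [hlog] at h3; linarith
  obtain ⟨base, hbase⟩ : ∃ base, base = 2 + max (Real.log (x + h) / 3 - Real.log (3 * h)) 0 * (1 + 5 * X) + 1.125 * (h / 80) := ⟨_, rfl⟩
  obtain ⟨Tv, hTv⟩ : ∃ Tv, Tv = 2 * (X / 375000 * (1 + L / 7)) + 0.2919 * h / cfr L := ⟨_, rfl⟩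
  obtain ⟨N, hN1, hN2, hN3⟩ := cf_total x h X L hX hL hxX hhL hxh hlog.le hXL hno base Tv hbase hTv
  have key := cf_num x h X L hX hL hxX hhL hxh hlog base N hbase hN1
  rcases lt_or_ge X 375000 with hlt | hge
  · have hN := hN2 hlt
    have hL91 := hXL2 hlt
    rcases le_total L 40 with h40 | h40
    · have l := cf_log_lb (15 * 30) (by norm_num) 61 10 (by norm_num) (by norm_num)
      norm_num at l
      exact key 30 6.1 0.039 0.6225 0 (by norm_num) hL (by norm_num; exact l) (by norm_num) (by norm_num)
        (by norm_num) (by linarith) (by norm_num) (by norm_num) (by linarith) (by norm_num)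
    rcases le_total L 60 with h60 | h60
    · have l := cf_log_lb (15 * 40) (by norm_num) 127 20 (by norm_num) (by norm_num)
      norm_num at l
      exact key 40 6.35 0.085 0.498 0 (by norm_num) h40 (by norm_num; exact l) (by norm_num) (by norm_num)
        (by norm_num) (by linarith) (by norm_num) (by norm_num) (by linarith) (by norm_num)
    · have l := cf_log_lb (15 * 60) (by norm_num) 68 10 (by norm_num) (by norm_num)
      norm_num at l
      exact key 60 6.8 0.117 0.36 0 (by norm_num) h60 (by norm_num; exact l) (by norm_num) (by norm_num)
        (by norm_num) (by linarith) (by norm_num) (by norm_num) (by linarith) (by norm_num)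
  · have h89 := hXL hge
    have hTT := cf_T h X L hX hL hhL Tv
    rcases le_total L 110 with h110 | h110
    · have l := cf_log_lb (15 * 89) (by norm_num) 143 20 (by norm_num) (by norm_num)
      norm_num at l
      have hT := hTT 2.45 0.1192 hTv (by norm_num) (by norm_num; linarith) (by norm_num)
      exact key 89 7.15 0.1256 0.2574 0.1192 (by norm_num) h89 (by norm_num; exact l) (by norm_num) (by norm_num)
        (by norm_num) (by linarith) (by norm_num) (by norm_num) (by linarith) (by norm_num)
    rcases le_total L 150 with h150 | h150
    · have l := cf_log_lb (15 * 110) (by norm_num) 74 10 (by norm_num) (by norm_num)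
      norm_num at l
      have hT := hTT 2.55 0.1145 hTv (by norm_num) (by norm_num; linarith) (by norm_num)
      exact key 110 7.4 0.1412 0.215 0.1145 (by norm_num) h110 (by norm_num; exact l) (by norm_num) (by norm_num)
        (by norm_num) (by linarith) (by norm_num) (by norm_num) (by linarith) (by norm_num)
    rcases le_total L 300 with h300 | h300
    · have l := cf_log_lb (15 * 150) (by norm_num) 77 10 (by norm_num) (by norm_num)
      norm_num at l
      have hT := hTT 2.72 0.1074 hTv (by norm_num) (by norm_num; linarith) (by norm_num)
      exact key 150 7.7 0.165 0.164 0.1074 (by norm_num) h150 (by norm_num; exact l) (by norm_num) (by norm_num)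
        (by norm_num) (by linarith) (by norm_num) (by norm_num) (by linarith) (by norm_num)
    · have l := cf_log_lb (15 * 300) (by norm_num) 84 10 (by norm_num) (by norm_num)
      norm_num at l
      have hT := hTT 3.12 0.0936 hTv (by norm_num) (by norm_num; linarith) (by norm_num)
      exact key 300 8.4 0.1905 0.089 0.0936 (by norm_num) h300 (by norm_num; exact l) (by norm_num) (by norm_num)
        (by norm_num) (by linarith) (by norm_num) (by norm_num) (by linarith) (by norm_num)

lemma cf_exp_ub (E : ℝ) (hE : 0 < E) (p q : ℕ) (hq : 0 < q) (h : (2.7182818286:ℝ) ^ p ≤ E ^ q) :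
    Real.exp ((p:ℝ) / q) ≤ E := by
  rw [← Real.le_log_iff_exp_le hE]
  exact cf_log_lb E hE p q hq h

lemma cf_small_piece (x L h : ℝ) (hx : x = Real.exp L) (hh : h = 5 * L * Real.exp (L / 7))
    (hno : ∀ n : ℕ, x < n → (n : ℝ) ≤ x + h → ∃ p : ℕ, p.Prime ∧ p ^ 3 ∣ n)
    (a b k E : ℝ) (ha : 1 ≤ a) (haL : a ≤ L) (hLb : L ≤ b) (hk : 0 ≤ k) (hxk : x + h ≤ k ^ 3 * x)
    (hE : Real.exp (4 * b / 21) ≤ E)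
    (hfin : 4 < (4.1225 * a - k * E / 3) * (1 + a / 7)) : False := by
  classical
  have hx0 : 0 < x := by rw [hx]; positivity
  have hs := Real.add_one_le_exp (L / 7)
  have hs0 := Real.exp_pos (L / 7)
  have hh0 : 0 < h := by rw [hh]; have : 0 < L := by linarith
                         positivity
  set P := (Finset.range (⌊x + h⌋₊ + 1)).filter
    (fun p : ℕ => p.Prime ∧ ∃ m : ℕ, x < m * (p:ℝ) ^ 3 ∧ m * (p:ℝ) ^ 3 ≤ x + h) with hP
  have hpb : ∀ p : ℕ, (∃ m : ℕ, x < m * (p:ℝ) ^ 3 ∧ m * (p:ℝ) ^ 3 ≤ x + h) → (p:ℝ) ^ 3 ≤ x + h := by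
    rintro p ⟨m, h1, h2⟩
    have hm : m ≠ 0 := by
      rintro rfl
      simp at h1; linarith
    have hm1 : (1:ℝ) ≤ m := by exact_mod_cast Nat.one_le_iff_ne_zero.2 hm
    have : (0:ℝ) ≤ (p:ℝ) ^ 3 := by positivity
    nlinarith
  have hmain := cf_count_main x h hx0.le hh0 hno P (fun p hp => (Finset.mem_filter.1 hp).2.1) (by
    intro p hp hm
    rw [hP, Finset.mem_filter, Finset.mem_range]
    refine ⟨Nat.lt_succ_of_le (Nat.le_floor ?_), hp, hm⟩
    have hp1 : (1:ℝ) ≤ p := by exact_mod_cast hp.one_lt.le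
    have h3 : (p:ℝ) ≤ (p:ℝ) ^ 3 := le_self_pow₀ hp1 (by norm_num)
    linarith [hpb p hm])
  have hy3 : Real.exp (L / 3) ^ 3 = x := by
    rw [← Real.exp_nat_mul, hx]; congr 1; push_cast; ring
  have hc := cf_primes_le P (fun p hp => (Finset.mem_filter.1 hp).2.1) (k * Real.exp (L / 3))
    (by positivity) (by
      intro p hp
      have h1 := hpb p (Finset.mem_filter.1 hp).2.2
      have h2 : (p:ℝ) ^ 3 ≤ (k * Real.exp (L / 3)) ^ 3 := by
        rw [mul_pow, hy3]; linarith
      exact le_of_pow_le_pow_left₀ (by norm_num) (by positivity) h2)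
  have hy : Real.exp (L / 3) ≤ Real.exp (L / 7) * E := by
    have h1 : Real.exp (L / 3) = Real.exp (L / 7) * Real.exp (4 * L / 21) := by
      rw [← Real.exp_add]; congr 1; ring
    rw [h1]
    apply mul_le_mul_of_nonneg_left _ hs0.le
    exact (Real.exp_le_exp.2 (by linarith)).trans hE
  have hky := mul_le_mul_of_nonneg_left hy hk
  have hpos : 0 < 4.1225 * a - k * E / 3 := by
    by_contra hcon
    push Not at hcon
    nlinarith
  have h6 : (4.1225 * a - k * E / 3) * (1 + a / 7) ≤ (4.1225 * a - k * E / 3) * Real.exp (L / 7) :=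
    mul_le_mul_of_nonneg_left (by linarith) hpos.le
  have h7 : a * Real.exp (L / 7) ≤ L * Real.exp (L / 7) := mul_le_mul_of_nonneg_right haL hs0.le
  linarith

lemma cf_medium (x L h : ℝ) (hx : x = Real.exp L) (hh : h = 5 * L * Real.exp (L / 7))
    (hno : ∀ n : ℕ, x < n → (n : ℝ) ≤ x + h → ∃ p : ℕ, p.Prime ∧ p ^ 3 ∣ n)
    (hL : 1.9 ≤ L) (hL30 : L ≤ 30) : False := by
  have key := cf_small_piece x L h hx hh hno
  have hs0 := Real.exp_pos (L / 7)
  have hxs : x = Real.exp (6 * L / 7) * Real.exp (L / 7) := by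
    rw [hx, ← Real.exp_add]; congr 1; ring
  have hκ : ∀ κ : ℝ, 5 * L ≤ κ * Real.exp (6 * L / 7) → x + h ≤ (1 + κ) * x := by
    intro κ hk
    have h1 := mul_le_mul_of_nonneg_right hk hs0.le
    have h2 : κ * x = κ * Real.exp (6 * L / 7) * Real.exp (L / 7) := by rw [hxs]; ring
    linarith
  rcases le_total L 12 with h12 | h12
  · have hk : x + h ≤ 1.45 ^ 3 * x := by
      have h1 : x + h ≤ (1 + 2) * x := by
        apply hκ
        have e1 : Real.exp (6 * L / 7) = Real.exp 1.6 * Real.exp (6 * L / 7 - 1.6) := by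
          rw [← Real.exp_add]; congr 1; ring
        have e2 := Real.add_one_le_exp (6 * L / 7 - 1.6)
        have e3 : 4.9 ≤ Real.exp 1.6 := by
          rw [← Real.log_le_iff_le_exp (by norm_num)]
          have := cf_log_ub 4.9 (by norm_num) 8 5 (by norm_num) (by norm_num)
          norm_num at this ⊢; exact this
        have e4 := Real.exp_pos 1.6
        rw [e1]
        have e5 : 4.9 * (6 * L / 7 - 1.6 + 1) ≤ Real.exp 1.6 * Real.exp (6 * L / 7 - 1.6) :=
          mul_le_mul e3 e2 (by linarith) e4.le
        linarith
      have hx0 : 0 < x := by rw [hx]; positivity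
      norm_num at h1 ⊢
      linarith
    rcases le_total L 4 with h4 | h4
    · have l := cf_exp_ub 2.2 (by norm_num) 16 21 (by norm_num) (by norm_num)
      exact key 1.9 4 1.45 2.2 (by norm_num) hL h4 (by norm_num) hk (by norm_num at l ⊢; exact l) (by norm_num)
    · have l := cf_exp_ub 10 (by norm_num) 16 7 (by norm_num) (by norm_num)
      exact key 4 12 1.45 10 (by norm_num) h4 h12 (by norm_num) hk (by norm_num at l ⊢; exact l) (by norm_num)
  · have hk : x + h ≤ 1.05 ^ 3 * x := by
      have h1 : x + h ≤ (1 + 0.15) * x := by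
        apply hκ
        have e1 : Real.exp (6 * L / 7) = Real.exp 10 * Real.exp (6 * L / 7 - 10) := by
          rw [← Real.exp_add]; congr 1; ring
        have e2 := Real.add_one_le_exp (6 * L / 7 - 10)
        have e3 : 20000 ≤ Real.exp 10 := by
          rw [← Real.log_le_iff_le_exp (by norm_num)]
          have := cf_log_ub 20000 (by norm_num) 10 1 (by norm_num) (by norm_num)
          norm_num at this ⊢; exact this
        have e4 := Real.exp_pos 10
        rw [e1]
        have e5 : 20000 * (6 * L / 7 - 10 + 1) ≤ Real.exp 10 * Real.exp (6 * L / 7 - 10) :=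
          mul_le_mul e3 e2 (by linarith) e4.le
        linarith
      have hx0 : 0 < x := by rw [hx]; positivity
      norm_num at h1 ⊢
      linarith
    rcases le_total L 24 with h24 | h24
    · have l := cf_exp_ub 98 (by norm_num) 32 7 (by norm_num) (by norm_num)
      exact key 12 24 1.05 98 (by norm_num) h12 h24 (by norm_num) hk (by norm_num at l ⊢; exact l) (by norm_num)
    rcases le_total L 28 with h28 | h28
    · have l := cf_exp_ub 210 (by norm_num) 16 3 (by norm_num) (by norm_num)
      exact key 24 28 1.05 210 (by norm_num) h24 h28 (by norm_num) hk (by norm_num at l ⊢; exact l) (by norm_num)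
    · have l := cf_exp_ub 305 (by norm_num) 40 7 (by norm_num) (by norm_num)
      exact key 28 30 1.05 305 (by norm_num) h28 hL30 (by norm_num) hk (by norm_num at l ⊢; exact l) (by norm_num)

theorem cubefree_in_interval (x : ℝ) (hx : 2 ≤ x) :
    ∃ n : ℕ, 0 < n ∧ x < (n : ℝ) ∧
      (n : ℝ) ≤ x + 5 * x ^ ((1 : ℝ) / 7) * Real.log x ∧
      ∀ p : ℕ, p.Prime → ¬ (p ^ 3 ∣ n) := by
  have hx0 : 0 < x := by linarith
  have hl2 : 0.69 ≤ Real.log x := by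
    have := Real.log_le_log (by norm_num) hx
    linarith [Real.log_two_gt_d9]
  rcases lt_or_ge x 7 with h7 | h7
  · refine ⟨⌊x⌋₊ + 1, by omega, by push_cast; exact Nat.lt_floor_add_one x, ?_, ?_⟩
    · have h1 := Nat.floor_le hx0.le
      have h2 : 1 ≤ x ^ ((1 : ℝ) / 7) := Real.one_le_rpow (by linarith) (by norm_num)
      push_cast
      nlinarith
    · intro p hp hd
      have h1 := Nat.le_of_dvd (by omega) hd
      have h2 : ⌊x⌋₊ < 7 := (Nat.floor_lt hx0.le).2 (by exact_mod_cast h7)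
      have h3 : 2 ^ 3 ≤ p ^ 3 := Nat.pow_le_pow_left hp.two_le 3
      omega
  · by_contra hcon
    have hno : ∀ n : ℕ, x < n → (n : ℝ) ≤ x + 5 * x ^ ((1 : ℝ) / 7) * Real.log x →
        ∃ p : ℕ, p.Prime ∧ p ^ 3 ∣ n := by
      intro n h1 h2
      by_contra h3
      push Not at h3
      refine hcon ⟨n, ?_, h1, h2, h3⟩
      have : (0:ℝ) < n := by linarith
      exact_mod_cast this
    rcases le_total 30 (Real.log x) with h30 | h30
    · exact cf_large x _ _ hx0 rfl h30 rfl hno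
    · have hl7 : 1.9 ≤ Real.log x := by
        have l := cf_log_lb 7 (by norm_num) 19 10 (by norm_num) (by norm_num)
        have := Real.log_le_log (by norm_num) h7
        norm_num at l ⊢
        linarith
      refine cf_medium x (Real.log x) _ (Real.exp_log hx0).symm ?_ hno hl7 h30
      rw [Real.rpow_def_of_pos hx0]
      rw [show Real.log x * (1 / 7) = Real.log x / 7 by ring]
      ring
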